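/- Let ω>0 and d_av≥0, and let f:ℝ→ℂ be a Schwartz function satisfying, for all x∈ℝ, the dispersion management equation ω·f(x) = d_av·f''(x) + (1/L)·∫₀^L T_{−D(s)}[ (T_{D(s)}f) · conj(T_{D(s)}f) · (T_{D(s)}f) ](x) ds. Then there exist constants C,μ>0 such that |f(x)| ≤ C·e^{−μ|x|} and |f̂(k)| ≤ C·e^{−μ|k|} for all x,k∈ℝ. -/

import Mathlib

open MeasureTheory Set

/-- The Fourier transform `ĝ(k) = (2π)^{-1/2} ∫ e^{ikx} g(x) dx`. -/
noncomputable def ft (g : ℝ → ℂ) (k : ℝ) : ℂ :=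
  ((Real.sqrt (2 * Real.pi) : ℂ))⁻¹ * ∫ x : ℝ, Complex.exp (Complex.I * k * x) * g x

/-- The free Schrödinger evolution
`T_r g(x) = (2π)^{-1/2} ∫ e^{-ixk} e^{-irk²} ĝ(k) dk`, i.e. `T_r = e^{ir∂ₓ²}`. -/
noncomputable def Tevol (r : ℝ) (g : ℝ → ℂ) (x : ℝ) : ℂ :=
  ((Real.sqrt (2 * Real.pi) : ℂ))⁻¹ *
    ∫ k : ℝ, Complex.exp (-(Complex.I * x * k)) *
      Complex.exp (-(Complex.I * r * k ^ 2)) * ft g k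

open Filter Topology
open scoped FourierTransform SchwartzMap

theorem AbsolutelyContinuousOnInterval.inv_of_le_abs {f : ℝ → ℝ} {a b δ : ℝ}
    (hf : AbsolutelyContinuousOnInterval f a b) (hδ : 0 < δ)
    (hle : ∀ x ∈ uIcc a b, δ ≤ |f x|) :
    AbsolutelyContinuousOnInterval (fun x ↦ (f x)⁻¹) a b := by
  rw [absolutelyContinuousOnInterval_iff] at hf ⊢
  intro ε hε
  obtain ⟨η, hη, h⟩ := hf (ε * δ ^ 2) (by positivity)
  refine ⟨η, hη, fun E hE hlt ↦ ?_⟩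
  have hsum := h E hE hlt
  have hpt : ∀ i ∈ Finset.range E.1, dist (f (E.2 i).1)⁻¹ (f (E.2 i).2)⁻¹ ≤
      (δ ^ 2)⁻¹ * dist (f (E.2 i).1) (f (E.2 i).2) := by
    intro i hi
    have h1 := hle _ (hE.1 i hi).1
    have h2 := hle _ (hE.1 i hi).2
    have n1 : f (E.2 i).1 ≠ 0 := fun h0 ↦ by simp [h0] at h1; linarith
    have n2 : f (E.2 i).2 ≠ 0 := fun h0 ↦ by simp [h0] at h2; linarith
    rw [Real.dist_eq, Real.dist_eq, inv_sub_inv n1 n2, abs_div, abs_sub_comm, abs_mul,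
      div_eq_inv_mul]
    gcongr
    nlinarith
  calc _ ≤ ∑ i ∈ Finset.range E.1, (δ ^ 2)⁻¹ * dist (f (E.2 i).1) (f (E.2 i).2) :=
        Finset.sum_le_sum hpt
    _ = (δ ^ 2)⁻¹ * ∑ i ∈ Finset.range E.1, dist (f (E.2 i).1) (f (E.2 i).2) := by
        rw [Finset.mul_sum]
    _ < (δ ^ 2)⁻¹ * (ε * δ ^ 2) := by gcongr
    _ = ε := by field_simp

/-- Integrating a function of `D` along an interval where `D'` is absolutely continuous and
bounded away from zero costs no more than the primitive of that function. -/
theorem exists_abs_integral_comp_le {a b δ : ℝ} (hab : a < b) {D G : ℝ → ℝ} (hδ : 0 < δ)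
    (hG : AbsolutelyContinuousOnInterval G a b) (hle : ∀ x ∈ Icc a b, δ ≤ |G x|)
    (hDc : ContinuousOn D (Icc a b)) (hD : ∀ x ∈ Ioo a b, HasDerivAt D (G x) x) :
    ∃ K : ℝ, 0 ≤ K ∧ ∀ Θ : ℝ → ℝ, Continuous Θ → ∀ M : ℝ,
      (∀ s ∈ Icc a b, |∫ v in (0:ℝ)..D s, Θ v| ≤ M) → |∫ s in a..b, Θ (D s)| ≤ K * M := by
  set h : ℝ → ℝ := fun x ↦ (G x)⁻¹ with hh
  have hAC : AbsolutelyContinuousOnInterval h a b :=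
    hG.inv_of_le_abs hδ (by rwa [uIcc_of_le hab.le])
  have hGc : ContinuousOn G (Icc a b) := by
    have := hG.continuousOn
    rwa [uIcc_of_le hab.le] at this
  refine ⟨2 * (|h b| + ∫ s in a..b, |deriv h s|), ?_, fun Θ hΘ M hM ↦ ?_⟩
  · have := intervalIntegral.integral_nonneg (μ := volume) hab.le
      (fun s _ ↦ abs_nonneg (deriv h s))
    positivity
  have hM0 : 0 ≤ M := (abs_nonneg _).trans (hM a ⟨le_rfl, hab.le⟩)
  set u : ℝ → ℝ := fun s ↦ ∫ v in (0:ℝ)..D s, Θ v with hu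
  have hprim : ∀ y, HasDerivAt (fun y ↦ ∫ v in (0:ℝ)..y, Θ v) (Θ y) y := fun y ↦
    intervalIntegral.integral_hasDerivAt_right (hΘ.intervalIntegrable _ _)
      (hΘ.stronglyMeasurableAtFilter _ _) hΘ.continuousAt
  have huc : ContinuousOn u (Icc a b) :=
    (continuous_iff_continuousAt.2 fun y ↦ (hprim y).continuousAt).comp_continuousOn hDc
  have hud : ∀ x ∈ Ioo a b, HasDerivAt u (Θ (D x) * G x) x := fun x hx ↦
    (hprim (D x)).comp x (hD x hx)
  have hic : ContinuousOn (fun s ↦ Θ (D s) * G s) (Icc a b) :=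
    (hΘ.comp_continuousOn hDc).mul hGc
  have hii : ∀ s ∈ Icc a b, IntervalIntegrable (fun s ↦ Θ (D s) * G s) volume a s := fun s hs ↦
    ContinuousOn.intervalIntegrable_of_Icc hs.1 (hic.mono (Icc_subset_Icc_right hs.2))
  set U : ℝ → ℝ := fun s ↦ ∫ t in a..s, Θ (D t) * G t with hU
  have hUu : ∀ s ∈ Icc a b, U s = u s - u a := fun s hs ↦
    intervalIntegral.integral_eq_sub_of_hasDerivAt_of_le hs.1
      (huc.mono (Icc_subset_Icc_right hs.2))
      (fun x hx ↦ hud x ⟨hx.1, hx.2.trans_le hs.2⟩) (hii s hs)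
  have hUM : ∀ s ∈ Icc a b, |U s| ≤ 2 * M := fun s hs ↦ by
    rw [hUu s hs]
    have := abs_sub (u s) (u a)
    linarith [hM s hs, hM a ⟨le_rfl, hab.le⟩]
  have hUAC : AbsolutelyContinuousOnInterval U a b :=
    (hii b ⟨hab.le, le_rfl⟩).absolutelyContinuousOnInterval_intervalIntegral left_mem_uIcc
  have hUd : ∀ x ∈ Ioo a b, deriv U x = Θ (D x) * G x := by
    intro x hx
    have : U =ᶠ[𝓝 x] fun s ↦ u s - u a := by
      filter_upwards [Icc_mem_nhds hx.1 hx.2] with s hs using hUu s hs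
    rw [this.deriv_eq]
    exact ((hud x hx).sub_const _).deriv
  have hibp := hAC.integral_mul_deriv_eq_deriv_mul hUAC
  have hUa : U a = 0 := by simp [hU]
  have hlhs : ∫ s in a..b, h s * deriv U s = ∫ s in a..b, Θ (D s) := by
    rw [intervalIntegral.integral_of_le hab.le, intervalIntegral.integral_of_le hab.le,
      integral_Ioc_eq_integral_Ioo, integral_Ioc_eq_integral_Ioo]
    refine setIntegral_congr_fun measurableSet_Ioo fun x hx ↦ ?_
    have hne : G x ≠ 0 := fun h0 ↦ by
      have := hle x (Ioo_subset_Icc_self hx)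
      simp [h0] at this
      linarith
    simp only [hUd x hx, hh]
    field_simp
  rw [hlhs, hUa, mul_zero, sub_zero] at hibp
  rw [hibp]
  have h1 : |∫ s in a..b, deriv h s * U s| ≤ ∫ s in a..b, |deriv h s| * (2 * M) := by
    rw [← Real.norm_eq_abs]
    refine intervalIntegral.norm_integral_le_of_norm_le hab.le (ae_of_all _ fun s hs ↦ ?_)
      (hAC.intervalIntegrable_deriv.abs.mul_const _)
    rw [Real.norm_eq_abs, abs_mul]
    gcongr
    exact hUM s (Ioc_subset_Icc_self hs)
  rw [intervalIntegral.integral_mul_const] at h1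
  have h2 : |h b * U b| ≤ |h b| * (2 * M) := by
    rw [abs_mul]
    gcongr
    exact hUM b ⟨hab.le, le_rfl⟩
  have h3 := abs_sub (h b * U b) (∫ s in a..b, deriv h s * U s)
  nlinarith

/-- A function agreeing a.e. with a function of class `W^{1,1}` on an open interval and bounded
away from zero has an absolutely continuous representative on the closed interval, bounded away
from zero, which is the classical derivative of its primitives. -/
theorem exists_absolutelyContinuous_deriv {α β δ : ℝ} (hαβ : α < β) {d0 g g' D : ℝ → ℝ}
    (hg' : IntegrableOn g' (Ioo α β))
    (hgg : ∀ x ∈ Ioo α β, ∀ y ∈ Ioo α β, g y - g x = ∫ t in x..y, g' t)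
    (hd0 : ∀ᵐ s ∂(volume.restrict (Ioo α β)), d0 s = g s)
    (hδ : ∀ᵐ s ∂(volume.restrict (Ioo α β)), δ ≤ |d0 s|)
    (hD : ∀ x ∈ Ioo α β, ∀ y ∈ Ioo α β, D y - D x = ∫ t in x..y, d0 t) :
    ∃ G : ℝ → ℝ, AbsolutelyContinuousOnInterval G α β ∧ (∀ x ∈ Icc α β, δ ≤ |G x|) ∧
      ∀ x ∈ Ioo α β, HasDerivAt D (G x) x := by
  set m := (α + β) / 2 with hm
  have hmem : m ∈ Ioo α β := ⟨by linarith, by linarith⟩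
  set k : ℝ → ℝ := (Ioo α β).indicator g' with hk
  have hki : Integrable k := (integrable_indicator_iff measurableSet_Ioo).2 hg'
  set G : ℝ → ℝ := fun s ↦ g m + ∫ t in m..s, k t with hG
  have hGc : Continuous G :=
    continuous_const.add (intervalIntegral.continuous_primitive
      (fun a b ↦ hki.intervalIntegrable) m)
  have hGg : ∀ s ∈ Ioo α β, G s = g s := by
    intro s hs
    have h1 := hgg m hmem s hs
    have h2 : ∫ t in m..s, k t = ∫ t in m..s, g' t := by
      refine intervalIntegral.integral_congr fun t ht ↦ ?_
      have : t ∈ Ioo α β := (ordConnected_Ioo.uIcc_subset hmem hs) ht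
      simp [hk, this.1, this.2]
    simp only [hG]
    linarith
  have hGd : ∀ᵐ s ∂(volume.restrict (Ioo α β)), d0 s = G s := by
    filter_upwards [hd0, ae_restrict_mem measurableSet_Ioo] with s h1 h2
    rw [h1, hGg s h2]
  refine ⟨G, ?_, ?_, fun x hx ↦ ?_⟩
  · have h1 : AbsolutelyContinuousOnInterval (fun s ↦ ∫ t in m..s, k t) α β :=
      (hki.intervalIntegrable).absolutelyContinuousOnInterval_intervalIntegral
        (by rw [uIcc_of_le hαβ.le]; exact Ioo_subset_Icc_self hmem)
    have h2 : AbsolutelyContinuousOnInterval (fun _ : ℝ ↦ g m) α β :=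
      (contDiff_const (n := 1)).contDiffOn.absolutelyContinuousOnInterval
    exact h2.add h1
  · have hcl : IsClosed {s | δ ≤ |G s|} := isClosed_le continuous_const hGc.abs
    have hsub : Ioo α β ⊆ {s | δ ≤ |G s|} := by
      by_contra hcon
      rw [not_subset] at hcon
      obtain ⟨x, hx, hxn⟩ := hcon
      have hpos : 0 < volume (Ioo α β ∩ {s | δ ≤ |G s|}ᶜ) :=
        (isOpen_Ioo.inter hcl.isOpen_compl).measure_pos _ ⟨x, hx, hxn⟩
      have hae : ∀ᵐ s ∂(volume.restrict (Ioo α β)), s ∈ {s | δ ≤ |G s|} := by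
        filter_upwards [hGd, hδ] with s h1 h2
        rw [h1] at h2
        exact h2
      rw [ae_iff] at hae
      have h0 : volume.restrict (Ioo α β) ({s | δ ≤ |G s|}ᶜ) = 0 := hae
      rw [Measure.restrict_apply hcl.measurableSet.compl, inter_comm] at h0
      exact hpos.ne' h0
    have := closure_minimal hsub hcl
    rw [closure_Ioo hαβ.ne] at this
    exact this
  · have hev : D =ᶠ[𝓝 x] fun y ↦ D x + ∫ t in x..y, G t := by
      filter_upwards [isOpen_Ioo.mem_nhds hx] with y hy
      have h1 := hD x hx y hy
      have h2 : ∫ t in x..y, d0 t = ∫ t in x..y, G t := by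
        refine intervalIntegral.integral_congr_ae ?_
        have h3 := (ae_restrict_iff' measurableSet_Ioo).1 hGd
        filter_upwards [h3] with t ht ht2
        exact ht ((ordConnected_Ioo.uIcc_subset hx hy) (uIoc_subset_uIcc ht2))
      linarith
    have hder : HasDerivAt (fun y ↦ ∫ t in x..y, G t) (G x) x :=
      intervalIntegral.integral_hasDerivAt_right (hGc.intervalIntegrable _ _)
        (hGc.stronglyMeasurableAtFilter _ _) hGc.continuousAt
    exact (hder.const_add (D x)).congr_of_eventuallyEq hev

theorem volume_zeros_eq_zero {α β δ : ℝ} {D G : ℝ → ℝ} (hδ : 0 < δ)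
    (hle : ∀ x ∈ Icc α β, δ ≤ |G x|) (hD : ∀ x ∈ Ioo α β, HasDerivAt D (G x) x) :
    volume {s | s ∈ Ioo α β ∧ D s = 0} = 0 := by
  have key : ∀ x ∈ Ioo α β, ∀ y ∈ Ioo α β, D x = 0 → D y = 0 → ¬ x < y := by
    intro x hx y hy h1 h2 hxy
    have hsub : Icc x y ⊆ Ioo α β := ordConnected_Ioo.out hx hy
    obtain ⟨c, hc, hc0⟩ := exists_hasDerivAt_eq_zero (f := D) (f' := G) hxy
      (fun z hz ↦ (hD z (hsub hz)).continuousAt.continuousWithinAt) (h1.trans h2.symm)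
      (fun z hz ↦ hD z (hsub (Ioo_subset_Icc_self hz)))
    have := hle c (Ioo_subset_Icc_self (hsub (Ioo_subset_Icc_self hc)))
    rw [hc0, abs_zero] at this
    linarith
  refine Set.Subsingleton.measure_zero (fun x hx y hy ↦ ?_) _
  exact le_antisymm (not_lt.1 (key y hy.1 x hx.1 hy.2 hx.2))
    (not_lt.1 (key x hx.1 y hy.1 hx.2 hy.2))

theorem exists_continuous_profile
    {L : ℝ} (hL : 0 < L) {d0 : ℝ → ℝ}
    (hd0int : IntegrableOn d0 (Icc 0 L))
    {D : ℝ → ℝ} (hD : ∀ s, D s = ∫ t in (0:ℝ)..s, d0 t)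
    (hbdd : ∃ δ > (0:ℝ), ∀ᵐ s ∂(volume.restrict (Icc (0:ℝ) L)), δ ≤ |d0 s|)
    (hpw : ∃ N : ℕ, 0 < N ∧ ∃ c : ℕ → ℝ,
      c 0 = 0 ∧ c N = L ∧ (∀ j < N, c j < c (j + 1)) ∧
      (∀ j < N, ∃ g g' : ℝ → ℝ,
        IntegrableOn g' (Ioo (c j) (c (j + 1))) ∧
        (∀ x ∈ Ioo (c j) (c (j + 1)), ∀ y ∈ Ioo (c j) (c (j + 1)),
          g y - g x = ∫ t in x..y, g' t) ∧
        (∀ᵐ s ∂(volume.restrict (Ioo (c j) (c (j + 1)))), d0 s = g s))) :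
    ∃ E : ℝ → ℝ, Continuous E ∧ (∀ s ∈ Icc 0 L, E s = D s) ∧
      (∃ U : ℝ, 0 < U ∧ ∀ s, |E s| ≤ U) ∧
      (∀ᵐ s ∂(volume.restrict (Ioc 0 L)), E s ≠ 0) ∧
      ∃ K : ℝ, 0 ≤ K ∧ ∀ Θ : ℝ → ℂ, Continuous Θ → ∀ M : ℝ,
        (∀ s, ‖∫ v in (0:ℝ)..E s, Θ v‖ ≤ M) → ‖∫ s in (0:ℝ)..L, Θ (E s)‖ ≤ K * M := by
  obtain ⟨δ, hδ, hδae⟩ := hbdd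
  obtain ⟨N, -, c, hc0, hcN, hcs, hpc⟩ := hpw
  have hmono : ∀ i j, i ≤ j → j ≤ N → c i ≤ c j := by
    intro i j hij
    induction j, hij using Nat.le_induction with
    | base => exact fun _ ↦ le_rfl
    | succ j hj ih => exact fun h ↦ (ih (by omega)).trans (hcs j (by omega)).le
  have hIcc : ∀ j < N, Icc (c j) (c (j + 1)) ⊆ Icc 0 L := fun j hj ↦
    Icc_subset_Icc (hc0 ▸ hmono 0 j (by omega) hj.le) (hcN ▸ hmono (j + 1) N hj le_rfl)
  have hii : ∀ a ∈ Icc 0 L, ∀ b ∈ Icc 0 L, IntervalIntegrable d0 volume a b := fun a ha b hb ↦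
    (hd0int.mono_set (ordConnected_Icc.uIcc_subset ha hb)).intervalIntegrable
  have h0 : (0:ℝ) ∈ Icc 0 L := ⟨le_rfl, hL.le⟩
  have hDsub : ∀ x ∈ Icc 0 L, ∀ y ∈ Icc 0 L, D y - D x = ∫ t in x..y, d0 t := by
    intro x hx y hy
    rw [hD, hD, intervalIntegral.integral_interval_sub_left (hii 0 h0 y hy) (hii 0 h0 x hx)]
  have hDc : ContinuousOn D (Icc 0 L) := by
    have := intervalIntegral.continuousOn_primitive_interval (a := 0) (b := L) (f := d0)
      (μ := volume) (by rwa [uIcc_of_le hL.le])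
    rw [uIcc_of_le hL.le] at this
    exact this.congr fun s _ ↦ hD s
  set E : ℝ → ℝ := IccExtend hL.le ((Icc 0 L).domRestrict D) with hE
  have hEc : Continuous E := (continuousOn_iff_continuous_domRestrict.1 hDc).Icc_extend'
  have hED : ∀ s ∈ Icc 0 L, E s = D s := fun s hs ↦ by
    simp [hE, IccExtend_of_mem hL.le _ hs]
  have hU : ∃ U : ℝ, 0 < U ∧ ∀ s, |E s| ≤ U := by
    obtain ⟨C, hC⟩ := isCompact_Icc.exists_bound_of_continuousOn hDc
    refine ⟨max C 1, by positivity, fun s ↦ (le_max_left _ _).trans' ?_⟩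
    exact hC _ (projIcc 0 L hL.le s).2
  have hpiece : ∀ j < N, ∃ G : ℝ → ℝ, AbsolutelyContinuousOnInterval G (c j) (c (j + 1)) ∧
      (∀ x ∈ Icc (c j) (c (j + 1)), δ ≤ |G x|) ∧
      ∀ x ∈ Ioo (c j) (c (j + 1)), HasDerivAt E (G x) x := by
    intro j hj
    obtain ⟨g, g', h1, h2, h3⟩ := hpc j hj
    have hsub : Ioo (c j) (c (j + 1)) ⊆ Icc 0 L := Ioo_subset_Icc_self.trans (hIcc j hj)
    refine exists_absolutelyContinuous_deriv (hcs j hj) h1 h2 h3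
      (ae_restrict_of_ae_restrict_of_subset hsub hδae) fun x hx y hy ↦ ?_
    rw [hED _ (hsub hx), hED _ (hsub hy), hDsub _ (hsub hx) _ (hsub hy)]
  have hnull : ∀ j ≤ N, volume {s | s ∈ Ioc 0 (c j) ∧ E s = 0} = 0 := by
    intro j
    induction j with
    | zero => simp [hc0]
    | succ j ih =>
      intro hj
      obtain ⟨G, -, hG1, hG2⟩ := hpiece j hj
      have hz := volume_zeros_eq_zero hδ hG1 hG2
      have hs : volume {c (j + 1)} = 0 := by simp
      refine measure_mono_null ?_
        (measure_union_null (measure_union_null (ih (by omega)) hz) hs)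
      rintro s ⟨⟨h1, h2⟩, h3⟩
      rcases le_or_gt s (c j) with h | h
      · exact Or.inl (Or.inl ⟨⟨h1, h⟩, h3⟩)
      · rcases h2.lt_or_eq with h' | h'
        · exact Or.inl (Or.inr ⟨⟨h, h'⟩, h3⟩)
        · exact Or.inr h'
  have hK : ∀ j < N, ∃ K : ℝ, 0 ≤ K ∧ ∀ Θ : ℝ → ℝ, Continuous Θ → ∀ M : ℝ,
      (∀ s ∈ Icc (c j) (c (j + 1)), |∫ v in (0:ℝ)..E s, Θ v| ≤ M) →
      |∫ s in (c j)..(c (j + 1)), Θ (E s)| ≤ K * M := by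
    intro j hj
    obtain ⟨G, h1, h2, h3⟩ := hpiece j hj
    exact exists_abs_integral_comp_le (hcs j hj) hδ h1 h2 hEc.continuousOn h3
  refine ⟨E, hEc, hED, hU, ?_, ?_⟩
  · rw [ae_restrict_iff' measurableSet_Ioc, ae_iff]
    have := hnull N le_rfl
    rw [hcN] at this
    convert this using 2
    ext s
    simp [and_assoc]
  choose! K hK0 hKb using hK
  have hreal : ∀ Θ : ℝ → ℝ, Continuous Θ → ∀ M : ℝ,
      (∀ s, |∫ v in (0:ℝ)..E s, Θ v| ≤ M) →
      |∫ s in (0:ℝ)..L, Θ (E s)| ≤ (∑ j ∈ Finset.range N, K j) * M := by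
    intro Θ hΘ M hM
    rw [← hc0, ← hcN, ← intervalIntegral.sum_integral_adjacent_intervals
      (f := fun s ↦ Θ (E s)) (fun j _ ↦ (hΘ.comp hEc).intervalIntegrable _ _), Finset.sum_mul]
    exact (Finset.abs_sum_le_sum_abs _ _).trans (Finset.sum_le_sum fun j hj ↦
      hKb j (Finset.mem_range.1 hj) Θ hΘ M fun s _ ↦ hM s)
  have hsum0 : 0 ≤ ∑ j ∈ Finset.range N, K j :=
    Finset.sum_nonneg fun j hj ↦ hK0 j (Finset.mem_range.1 hj)
  refine ⟨2 * ∑ j ∈ Finset.range N, K j, by positivity, fun Θ hΘ M hM ↦ ?_⟩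
  have hre := hreal (fun v ↦ (Θ v).re) (Complex.continuous_re.comp hΘ) M fun s ↦ by
    have := Complex.reCLM.intervalIntegral_comp_comm (hΘ.intervalIntegrable (μ := volume) 0 (E s))
    simp only [Complex.reCLM_apply] at this
    rw [this]
    exact (Complex.abs_re_le_norm _).trans (hM s)
  have him := hreal (fun v ↦ (Θ v).im) (Complex.continuous_im.comp hΘ) M fun s ↦ by
    have := Complex.imCLM.intervalIntegral_comp_comm (hΘ.intervalIntegrable (μ := volume) 0 (E s))
    simp only [Complex.imCLM_apply] at this
    rw [this]
    exact (Complex.abs_im_le_norm _).trans (hM s)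
  have hir := Complex.reCLM.intervalIntegral_comp_comm
    ((hΘ.comp hEc).intervalIntegrable (μ := volume) 0 L)
  have hiim := Complex.imCLM.intervalIntegral_comp_comm
    ((hΘ.comp hEc).intervalIntegrable (μ := volume) 0 L)
  simp only [Complex.reCLM_apply, Complex.imCLM_apply, Function.comp] at hir hiim
  rw [hir] at hre
  rw [hiim] at him
  have := Complex.norm_le_abs_re_add_abs_im (∫ s in (0:ℝ)..L, Θ (E s))
  linarith

theorem norm_integral_cexp_le {U u τ : ℝ} (hu : |u| ≤ U) (hτ : τ ≠ 0) :
    ‖∫ v in (0:ℝ)..u, Complex.exp (Complex.I * τ * v)‖ ≤ (2 + U) / √|τ| := by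
  have hτ' : 0 < |τ| := abs_pos.2 hτ
  have hs : 0 < √|τ| := Real.sqrt_pos.2 hτ'
  have hU : 0 ≤ U := (abs_nonneg _).trans hu
  have h1 : ‖∫ v in (0:ℝ)..u, Complex.exp (Complex.I * τ * v)‖ ≤ |u| := by
    have := intervalIntegral.norm_integral_le_of_norm_le_const (a := 0) (b := u) (C := 1)
      (f := fun v : ℝ ↦ Complex.exp (Complex.I * τ * v)) (fun v _ ↦ by
        rw [show Complex.I * τ * v = ((τ * v : ℝ) : ℂ) * Complex.I by push_cast; ring,
          Complex.norm_exp_ofReal_mul_I])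
    simpa using this
  have h2 : ‖∫ v in (0:ℝ)..u, Complex.exp (Complex.I * τ * v)‖ ≤ 2 / |τ| := by
    have hne : Complex.I * τ ≠ 0 := by simp [hτ]
    rw [integral_exp_mul_complex hne, norm_div]
    have h3 : ‖Complex.I * (τ : ℂ)‖ = |τ| := by simp
    rw [h3]
    gcongr
    refine (norm_sub_le _ _).trans ?_
    rw [show Complex.I * τ * u = ((τ * u : ℝ) : ℂ) * Complex.I by push_cast; ring,
      Complex.norm_exp_ofReal_mul_I]
    simp
    norm_num
  rcases le_total 1 (√|τ|) with h | h
  · refine h2.trans ?_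
    rw [div_le_div_iff₀ hτ' hs]
    nlinarith [Real.mul_self_sqrt hτ'.le]
  · refine h1.trans ?_
    rw [le_div_iff₀ hs]
    nlinarith [abs_nonneg u]

/-- The Fresnel phase `e^{-iτ/v}/|v|`, continuously cut off near `v = 0`. -/
noncomputable def fresnelCutoff (η τ v : ℝ) : ℂ :=
  ((max 0 (|v| - η) / v ^ 2 : ℝ) : ℂ) * Complex.exp (((-(τ / v) : ℝ) : ℂ) * Complex.I)

theorem norm_fresnelCutoff (η τ v : ℝ) :
    ‖fresnelCutoff η τ v‖ = max 0 (|v| - η) / v ^ 2 := by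
  rw [fresnelCutoff, norm_mul, Complex.norm_exp_ofReal_mul_I, mul_one, Complex.norm_real,
    Real.norm_eq_abs, abs_of_nonneg (by positivity)]

theorem fresnelCutoff_eq_zero {η τ v : ℝ} (h : |v| ≤ η) : fresnelCutoff η τ v = 0 := by
  rw [← norm_eq_zero, norm_fresnelCutoff, max_eq_left (by linarith), zero_div]

theorem continuous_fresnelCutoff {η : ℝ} (hη : 0 < η) (τ : ℝ) :
    Continuous (fresnelCutoff η τ) := by
  rw [continuous_iff_continuousAt]
  intro v
  rcases eq_or_ne v 0 with rfl | hv
  · have : fresnelCutoff η τ =ᶠ[𝓝 0] fun _ ↦ 0 := by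
      have h0 : ∀ᶠ w : ℝ in 𝓝 0, |w| < η :=
        (continuous_abs.tendsto (0:ℝ)).eventually_lt_const (by simpa using hη)
      filter_upwards [h0] with w hw using fresnelCutoff_eq_zero hw.le
    exact this.continuousAt
  · unfold fresnelCutoff
    have hv2 : v ^ 2 ≠ 0 := pow_ne_zero 2 hv
    fun_prop (disch := assumption)

theorem norm_integral_fresnelCutoff_le_div {η l τ : ℝ} (hη : 0 < η) (hl : 0 ≤ l) (hτ : τ ≠ 0) :
    ‖∫ v in (0:ℝ)..l, fresnelCutoff η τ v‖ ≤ 2 * l / |τ| := by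
  have hτ' : 0 < |τ| := abs_pos.2 hτ
  have hzero : ∀ b : ℝ, 0 ≤ b → b ≤ η → ∫ v in (0:ℝ)..b, fresnelCutoff η τ v = 0 := by
    intro b hb hbη
    refine intervalIntegral.integral_zero_ae (ae_of_all _ fun v hv ↦ ?_)
    rw [uIoc_of_le hb] at hv
    exact fresnelCutoff_eq_zero (by rw [abs_of_pos hv.1]; exact hv.2.trans hbη)
  rcases le_total l η with h | h
  · rw [hzero l hl h, norm_zero]
    positivity
  have hc := continuous_fresnelCutoff hη τ
  rw [← intervalIntegral.integral_add_adjacent_intervals (hc.intervalIntegrable 0 η)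
    (hc.intervalIntegrable η l), hzero η hη.le le_rfl, zero_add]
  set Ψ : ℝ → ℂ := fun v ↦ Complex.exp (((-(τ / v) : ℝ) : ℂ) * Complex.I) with hΨ
  have hΨn : ∀ v, ‖Ψ v‖ = 1 := fun v ↦ Complex.norm_exp_ofReal_mul_I _
  have hpos : ∀ v ∈ uIcc η l, 0 < v := fun v hv ↦ by
    rw [uIcc_of_le h] at hv
    exact hη.trans_le hv.1
  have hΨd : ∀ v ∈ uIcc η l, HasDerivAt Ψ (Ψ v * (((τ / v ^ 2 : ℝ) : ℂ) * Complex.I)) v := by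
    intro v hv
    have hv0 : v ≠ 0 := (hpos v hv).ne'
    have h1 : HasDerivAt (fun v : ℝ ↦ -(τ / v)) (τ / v ^ 2) v := by
      have := ((hasDerivAt_inv hv0).const_mul τ).neg
      convert! this using 1
      field_simp
    exact (h1.ofReal_comp.mul_const Complex.I).cexp
  have hld : ∀ v ∈ uIcc η l, HasDerivAt (fun v : ℝ ↦ ((v - η : ℝ) : ℂ)) 1 v := fun v _ ↦ by
    have := ((hasDerivAt_id v).sub_const η).ofReal_comp
    simpa using this
  have hΨ'c : ContinuousOn (fun v ↦ Ψ v * (((τ / v ^ 2 : ℝ) : ℂ) * Complex.I)) (uIcc η l) := by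
    intro v hv
    have hv0 : v ≠ 0 := (hpos v hv).ne'
    have hv2 : v ^ 2 ≠ 0 := pow_ne_zero 2 hv0
    refine ContinuousAt.continuousWithinAt ?_
    refine (hΨd v hv).continuousAt.mul ?_
    fun_prop (disch := assumption)
  have hibp := intervalIntegral.integral_mul_deriv_eq_deriv_mul hld hΨd
    (continuous_const.intervalIntegrable _ _) hΨ'c.intervalIntegrable
  have heq : ∫ v in η..l, fresnelCutoff η τ v = ((τ : ℂ) * Complex.I)⁻¹ *
      ∫ v in η..l, ((v - η : ℝ) : ℂ) * (Ψ v * (((τ / v ^ 2 : ℝ) : ℂ) * Complex.I)) := by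
    rw [← intervalIntegral.integral_const_mul]
    refine intervalIntegral.integral_congr fun v hv ↦ ?_
    have hv0 := hpos v hv
    have hv1 : η ≤ v := by rw [uIcc_of_le h] at hv; exact hv.1
    have hτc : (τ : ℂ) ≠ 0 := by exact_mod_cast hτ
    have hvc : (v : ℂ) ≠ 0 := by exact_mod_cast hv0.ne'
    simp only [fresnelCutoff, hΨ]
    rw [abs_of_pos hv0, max_eq_right (by linarith)]
    push_cast
    have hI := Complex.I_ne_zero
    field_simp
  rw [heq, hibp, norm_mul, norm_inv]
  have h3 : ‖(τ : ℂ) * Complex.I‖ = |τ| := by simp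
  have h4 : ‖∫ v in η..l, 1 * Ψ v‖ ≤ l - η := by
    have := intervalIntegral.norm_integral_le_of_norm_le_const (a := η) (b := l) (C := 1)
      (f := fun v : ℝ ↦ 1 * Ψ v) (fun v _ ↦ by rw [one_mul, hΨn])
    rwa [one_mul, abs_of_nonneg (by linarith)] at this
  have h5 : ‖((l - η : ℝ) : ℂ) * Ψ l - ((η - η : ℝ) : ℂ) * Ψ η‖ = l - η := by
    rw [sub_self, Complex.ofReal_zero, zero_mul, sub_zero, norm_mul, hΨn, mul_one,
      Complex.norm_real, Real.norm_eq_abs, abs_of_nonneg (by linarith)]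
  rw [h3, inv_mul_eq_div]
  gcongr
  refine (norm_sub_le _ _).trans ?_
  rw [h5]
  linarith

theorem norm_integral_fresnelCutoff_le {η U u τ : ℝ} (hη : 0 < η) (hu : |u| ≤ U) (hτ : τ ≠ 0) :
    ‖∫ v in (0:ℝ)..u, fresnelCutoff η τ v‖ ≤ (2 + U) / √|τ| := by
  wlog hu0 : 0 ≤ u generalizing u τ
  · have h1 := this (u := -u) (τ := -τ) (by rwa [abs_neg]) (neg_ne_zero.2 hτ) (by linarith)
    rw [abs_neg] at h1
    refine le_trans (le_of_eq ?_) h1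
    have h2 : ∀ v, fresnelCutoff η (-τ) v = fresnelCutoff η τ (-v) := fun v ↦ by
      simp [fresnelCutoff, neg_div, div_neg]
    simp_rw [h2]
    rw [intervalIntegral.integral_comp_neg, neg_neg, neg_zero, intervalIntegral.integral_symm,
      norm_neg]
  rw [abs_of_nonneg hu0] at hu
  have hτ' : 0 < |τ| := abs_pos.2 hτ
  have hs : 0 < √|τ| := Real.sqrt_pos.2 hτ'
  have hsq := Real.mul_self_sqrt hτ'.le
  rcases le_total u (√|τ|) with h | h
  · refine (norm_integral_fresnelCutoff_le_div hη hu0 hτ).trans ?_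
    rw [div_le_div_iff₀ hτ' hs]
    nlinarith
  · have hc := continuous_fresnelCutoff hη τ
    rw [← intervalIntegral.integral_add_adjacent_intervals (hc.intervalIntegrable 0 (√|τ|))
      (hc.intervalIntegrable (√|τ|) u)]
    have h1 := norm_integral_fresnelCutoff_le_div hη hs.le hτ
    have h2 : ‖∫ v in (√|τ|)..u, fresnelCutoff η τ v‖ ≤ (√|τ|)⁻¹ * |u - (√|τ|)| := by
      refine intervalIntegral.norm_integral_le_of_norm_le_const fun v hv ↦ ?_
      rw [uIoc_of_le h] at hv
      have hv0 : 0 < v := hs.trans hv.1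
      rw [norm_fresnelCutoff, abs_of_pos hv0]
      have h3 : max 0 (v - η) ≤ v := max_le hv0.le (by linarith)
      calc max 0 (v - η) / v ^ 2 ≤ v / v ^ 2 := by gcongr
        _ = v⁻¹ := by field_simp
        _ ≤ (√|τ|)⁻¹ := by gcongr; exact hv.1.le
    rw [abs_of_nonneg (sub_nonneg.2 h)] at h2
    refine (norm_add_le _ _).trans ?_
    have h4 : 2 * √|τ| / |τ| = 2 / √|τ| := by
      rw [div_eq_div_iff hτ'.ne' hs.ne']
      nlinarith
    have h5 : (√|τ|)⁻¹ * (u - √|τ|) ≤ U / √|τ| := by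
      rw [inv_mul_eq_div]
      gcongr
      linarith
    rw [add_div]
    linarith

/-- The product of an inverse-square weight with a kernel, integrated. -/
noncomputable def weightConv (κ : ℝ → ENNReal) (k : ℝ) : ENNReal :=
  ∫⁻ a, κ a * ENNReal.ofReal (((1 + |k - a|) ^ 2)⁻¹)

theorem prod_inv_sq_weight_le (k a b : ℝ) :
    ((1 + |k - a|) ^ 2)⁻¹ * ((1 + |k - a - b|) ^ 2)⁻¹ * ((1 + |k - b|) ^ 2)⁻¹ ≤
      3 * ((1 + |k|) ^ 2)⁻¹ *
        (((1 + |k - a - b|) ^ 2)⁻¹ * ((1 + |k - b|) ^ 2)⁻¹ +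
          ((1 + |k - a|) ^ 2)⁻¹ * ((1 + |k - b|) ^ 2)⁻¹ +
          ((1 + |k - a|) ^ 2)⁻¹ * ((1 + |k - a - b|) ^ 2)⁻¹) := by
  have h : |k| ≤ |k - a| + |k - a - b| + |k - b| := by
    have := abs_add_three (k - a) (-(k - a - b)) (k - b)
    rw [abs_neg] at this
    rwa [show k - a + -(k - a - b) + (k - b) = k by ring] at this
  have h1 := abs_nonneg (k - a)
  have h2 := abs_nonneg (k - a - b)
  have h3 := abs_nonneg (k - b)
  have h0 := abs_nonneg k
  generalize |k - a| = x at *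
  generalize |k - a - b| = y at *
  generalize |k - b| = z at *
  generalize |k| = w at *
  have hw : (1 + w) ^ 2 ≤ 3 * ((1 + x) ^ 2 + (1 + y) ^ 2 + (1 + z) ^ 2) := by
    have : (1 + w) ^ 2 ≤ ((1 + x) + (1 + y) + (1 + z)) ^ 2 :=
      pow_le_pow_left₀ (by positivity) (by linarith) 2
    nlinarith [sq_nonneg (x - y), sq_nonneg (y - z), sq_nonneg (x - z)]
  have hx : 0 < (1 + x) ^ 2 := by positivity
  have hy : 0 < (1 + y) ^ 2 := by positivity
  have hz : 0 < (1 + z) ^ 2 := by positivity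
  have hw0 : 0 < (1 + w) ^ 2 := by positivity
  generalize (1 + x) ^ 2 = X at *
  generalize (1 + y) ^ 2 = Y at *
  generalize (1 + z) ^ 2 = Z at *
  generalize (1 + w) ^ 2 = W at *
  field_simp
  linarith

theorem lintegral_lintegral_prod_weight_le {κ : ℝ → ENNReal} (hκ : Measurable κ) {C : ENNReal}
    (hC : ∀ k, weightConv κ k ≤ C) (k : ℝ) :
    ∫⁻ a, ∫⁻ b, κ a * κ b * ENNReal.ofReal (((1 + |k - a|) ^ 2)⁻¹ *
        ((1 + |k - a - b|) ^ 2)⁻¹ * ((1 + |k - b|) ^ 2)⁻¹) ≤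
      9 * C * ENNReal.ofReal (((1 + |k|) ^ 2)⁻¹) * weightConv κ k := by
  set W : ℝ → ENNReal := fun x ↦ ENNReal.ofReal (((1 + |x|) ^ 2)⁻¹) with hW
  have hWm : Measurable W := by fun_prop
  have hΦ : ∀ k, weightConv κ k = ∫⁻ a, κ a * W (k - a) := fun k ↦ rfl
  have h2 : ∫⁻ a, ∫⁻ b, κ a * W (k - a) * (κ b * W (k - b)) ≤ C * weightConv κ k := by
    have : ∀ a, ∫⁻ b, κ a * W (k - a) * (κ b * W (k - b)) = κ a * W (k - a) * weightConv κ k :=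
      fun a ↦ by rw [lintegral_const_mul _ (by fun_prop), hΦ]
    simp_rw [this]
    rw [lintegral_mul_const _ (by fun_prop), ← hΦ]
    gcongr
    exact hC k
  have h3 : ∫⁻ a, ∫⁻ b, κ a * W (k - a) * (κ b * W (k - a - b)) ≤ C * weightConv κ k := by
    have : ∀ a, ∫⁻ b, κ a * W (k - a) * (κ b * W (k - a - b)) ≤ κ a * W (k - a) * C :=
      fun a ↦ by
        rw [lintegral_const_mul _ (by fun_prop), ← hΦ]
        gcongr
        exact hC _
    refine (lintegral_mono this).trans ?_
    rw [lintegral_mul_const _ (by fun_prop), ← hΦ, mul_comm]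
  have h1 : ∫⁻ a, ∫⁻ b, κ b * W (k - b) * (κ a * W (k - a - b)) ≤ C * weightConv κ k := by
    rw [lintegral_lintegral_swap (by fun_prop)]
    refine le_trans (le_of_eq ?_) h3
    refine lintegral_congr fun a ↦ lintegral_congr fun b ↦ ?_
    rw [sub_right_comm]
  have hpt : ∀ a b, κ a * κ b * ENNReal.ofReal (((1 + |k - a|) ^ 2)⁻¹ *
        ((1 + |k - a - b|) ^ 2)⁻¹ * ((1 + |k - b|) ^ 2)⁻¹) ≤
      3 * W k * (κ b * W (k - b) * (κ a * W (k - a - b)) +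
        κ a * W (k - a) * (κ b * W (k - b)) + κ a * W (k - a) * (κ b * W (k - a - b))) := by
    intro a b
    refine (mul_le_mul_right (ENNReal.ofReal_le_ofReal (prod_inv_sq_weight_le k a b)) _).trans
      (le_of_eq ?_)
    rw [ENNReal.ofReal_mul (by positivity), ENNReal.ofReal_mul (by positivity),
      ENNReal.ofReal_add (by positivity) (by positivity),
      ENNReal.ofReal_add (by positivity) (by positivity),
      ENNReal.ofReal_mul (by positivity), ENNReal.ofReal_mul (by positivity),
      ENNReal.ofReal_mul (by positivity)]
    simp only [hW, ENNReal.ofReal_ofNat]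
    ring
  refine (lintegral_mono fun a ↦ lintegral_mono fun b ↦ hpt a b).trans ?_
  have h4 : ∀ a, ∫⁻ b, 3 * W k * (κ b * W (k - b) * (κ a * W (k - a - b)) +
        κ a * W (k - a) * (κ b * W (k - b)) + κ a * W (k - a) * (κ b * W (k - a - b))) =
      3 * W k * ((∫⁻ b, κ b * W (k - b) * (κ a * W (k - a - b))) +
        (∫⁻ b, κ a * W (k - a) * (κ b * W (k - b))) +
        ∫⁻ b, κ a * W (k - a) * (κ b * W (k - a - b))) := fun a ↦ by
    rw [lintegral_const_mul _ (by fun_prop), lintegral_add_left (by fun_prop),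
      lintegral_add_left (by fun_prop)]
  simp_rw [h4]
  have hm1 : Measurable fun a ↦ ∫⁻ b, κ b * W (k - b) * (κ a * W (k - a - b)) :=
    Measurable.lintegral_prod_right (by fun_prop)
  have hm2 : Measurable fun a ↦ ∫⁻ b, κ a * W (k - a) * (κ b * W (k - b)) :=
    Measurable.lintegral_prod_right (by fun_prop)
  have hm3 : Measurable fun a ↦ ∫⁻ b, κ a * W (k - a) * (κ b * W (k - a - b)) :=
    Measurable.lintegral_prod_right (by fun_prop)
  rw [lintegral_const_mul _ (by fun_prop), lintegral_add_left (by fun_prop),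
    lintegral_add_left (by fun_prop)]
  calc _ ≤ 3 * W k * (C * weightConv κ k + C * weightConv κ k + C * weightConv κ k) := by
        gcongr
    _ = _ := by ring

theorem exists_weightConv_one_le : ∃ C : ℝ, 0 < C ∧
    ∀ k, weightConv (fun _ ↦ 1) k ≤ ENNReal.ofReal C := by
  have h_int : Integrable (fun x : ℝ ↦ ((1 + |x|) ^ 2)⁻¹) := by
    have := integrable_one_add_norm (E := ℝ) (μ := volume) (r := 2) (by simp)
    refine this.congr (Eventually.of_forall fun x ↦ ?_)
    simp only [Real.norm_eq_abs]
    rw [Real.rpow_neg (by positivity)]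
    norm_num
  refine ⟨1 + ∫ x : ℝ, ((1 + |x|) ^ 2)⁻¹, by positivity, fun k ↦ ?_⟩
  simp only [weightConv, one_mul]
  rw [lintegral_sub_left_eq_self (fun x ↦ ENNReal.ofReal (((1 + |x|) ^ 2)⁻¹)) k,
    ← ofReal_integral_eq_lintegral_ofReal h_int (Eventually.of_forall fun x ↦ by positivity)]
  exact ENNReal.ofReal_le_ofReal (by linarith)

theorem integrableOn_inv_sqrt_abs : IntegrableOn (fun x : ℝ ↦ (√|x|)⁻¹) (Icc (-1) 1) := by
  have h1 : IntervalIntegrable (fun x : ℝ ↦ (√|x|)⁻¹) volume 0 1 := by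
    refine (intervalIntegral.intervalIntegrable_rpow' (r := -(1 / 2)) (by norm_num)).congr ?_
    intro x hx
    rw [uIoc_of_le zero_le_one] at hx
    simp only
    rw [abs_of_pos hx.1, Real.rpow_neg hx.1.le, Real.sqrt_eq_rpow]
  have h2 : IntervalIntegrable (fun x : ℝ ↦ (√|x|)⁻¹) volume (-1) 0 := by
    have := h1.comp_sub_left 0
    simpa using this.symm
  have h3 := h2.trans h1
  rwa [intervalIntegrable_iff_integrableOn_Icc_of_le (by norm_num)] at h3

theorem exists_weightConv_inv_sqrt_le : ∃ C : ℝ, 0 < C ∧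
    ∀ k, weightConv (fun a ↦ ENNReal.ofReal (√|a|)⁻¹) k ≤
      ENNReal.ofReal (C * (√(1 + |k|))⁻¹) := by
  set G : ℝ → ℝ := fun x ↦ √(1 + |x|) * ((1 + |x|) ^ 2)⁻¹ with hG
  have hGint : Integrable G := by
    have := integrable_one_add_norm (E := ℝ) (μ := volume) (r := 3 / 2) (by norm_num)
    refine this.congr (Eventually.of_forall fun x ↦ ?_)
    have h : 0 < 1 + |x| := by positivity
    simp only [Real.norm_eq_abs, hG]
    rw [Real.sqrt_eq_rpow, ← Real.rpow_natCast, ← Real.rpow_neg h.le, ← Real.rpow_add h]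
    norm_num
  set H : ℝ → ℝ := (Icc (-1) 1).indicator fun x : ℝ ↦ (√|x|)⁻¹ with hH
  have hHint : Integrable H := integrableOn_inv_sqrt_abs.integrable_indicator measurableSet_Icc
  have hG0 : ∀ x, 0 ≤ G x := fun x ↦ by positivity
  have hH0 : ∀ x, 0 ≤ H x := fun x ↦ indicator_nonneg (fun x _ ↦ by positivity) x
  have hG1 : ∀ x, G x ≤ 1 := fun x ↦ by
    have h : 1 ≤ 1 + |x| := by linarith [abs_nonneg x]
    simp only [hG]
    rw [mul_inv_le_iff₀ (by positivity), one_mul]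
    refine (Real.sqrt_le_self_iff).2 ?_ |>.trans ?_
    · exact Or.inr h
    · nlinarith
  have hGHint : Integrable fun x ↦ G x + H x := hGint.add hHint
  refine ⟨1 + 2 * ∫ x, G x + H x, ?_, fun k ↦ ?_⟩
  · have : 0 ≤ ∫ x, G x + H x := integral_nonneg fun x ↦ add_nonneg (hG0 x) (hH0 x)
    linarith
  have hk : 0 < 1 + |k| := by positivity
  have hpt : ∀ a, (√|a|)⁻¹ * ((1 + |k - a|) ^ 2)⁻¹ ≤
      (√(1 + |k|))⁻¹ * (2 * (G (k - a) + H a)) := by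
    intro a
    rw [← div_eq_inv_mul (2 * _), le_div_iff₀ (Real.sqrt_pos.2 hk)]
    have h1 : √(1 + |k|) ≤ √(1 + |k - a|) * √(1 + |a|) := by
      rw [← Real.sqrt_mul (by positivity)]
      refine Real.sqrt_le_sqrt ?_
      have := abs_add_le (k - a) a
      rw [sub_add_cancel] at this
      nlinarith [abs_nonneg (k - a), abs_nonneg a]
    have h2 : (√|a|)⁻¹ * ((1 + |k - a|) ^ 2)⁻¹ * √(1 + |k|) ≤
        (√|a|)⁻¹ * √(1 + |a|) * G (k - a) := by
      calc _ ≤ (√|a|)⁻¹ * ((1 + |k - a|) ^ 2)⁻¹ * (√(1 + |k - a|) * √(1 + |a|)) := by gcongr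
        _ = _ := by simp only [hG]; ring
    refine h2.trans ?_
    rcases le_total |a| 1 with ha | ha
    · have h3 : √(1 + |a|) ≤ 2 := by
        rw [Real.sqrt_le_left (by norm_num)]
        linarith
      have h4 : H a = (√|a|)⁻¹ := indicator_of_mem (mem_Icc.2 (abs_le.1 ha)) _
      calc _ ≤ (√|a|)⁻¹ * 2 * 1 := by
            gcongr
            exact hG1 _
        _ = 2 * H a := by rw [h4]; ring
        _ ≤ _ := by linarith [hG0 (k - a)]
    · have h3 : (√|a|)⁻¹ * √(1 + |a|) ≤ 2 := by
        rw [inv_mul_le_iff₀ (Real.sqrt_pos.2 (by linarith)), mul_comm]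
        rw [Real.sqrt_le_left (by positivity), mul_pow, Real.sq_sqrt (by positivity)]
        linarith
      calc _ ≤ 2 * G (k - a) := by
            gcongr
        _ ≤ _ := by linarith [hH0 a]
  have h_int2 : Integrable fun a ↦ (√(1 + |k|))⁻¹ * (2 * (G (k - a) + H a)) :=
    (((hGint.comp_sub_left k).add hHint).const_mul 2).const_mul _
  simp only [weightConv]
  calc _ = ∫⁻ a, ENNReal.ofReal ((√|a|)⁻¹ * ((1 + |k - a|) ^ 2)⁻¹) := by
        refine lintegral_congr fun a ↦ ?_
        rw [ENNReal.ofReal_mul (by positivity)]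
    _ ≤ ∫⁻ a, ENNReal.ofReal ((√(1 + |k|))⁻¹ * (2 * (G (k - a) + H a))) :=
        lintegral_mono fun a ↦ ENNReal.ofReal_le_ofReal (hpt a)
    _ = ENNReal.ofReal (∫ a, (√(1 + |k|))⁻¹ * (2 * (G (k - a) + H a))) :=
        (ofReal_integral_eq_lintegral_ofReal h_int2 (Eventually.of_forall fun a ↦
          mul_nonneg (by positivity)
            (mul_nonneg zero_le_two (add_nonneg (hG0 _) (hH0 a))))).symm
    _ ≤ _ := by
        refine ENNReal.ofReal_le_ofReal ?_
        rw [integral_const_mul, integral_const_mul, integral_add (hGint.comp_sub_left k) hHint,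
          integral_sub_left_eq_self G volume k, ← integral_add hGint hHint, mul_comm]
        gcongr
        linarith

/-- An inverse-square weight times a truncated exponential. -/
noncomputable def decayWeight (μ n x : ℝ) : ℝ :=
  ((1 + |x|) ^ 2)⁻¹ * Real.exp (-(μ * min |x| n))

theorem decayWeight_pos (μ n x : ℝ) : 0 < decayWeight μ n x := by
  unfold decayWeight
  positivity

theorem min_abs_add_three_le {n : ℝ} (hn : 0 ≤ n) (k a b : ℝ) :
    min |k| n ≤ min |k - a| n + min |k - a - b| n + min |k - b| n := by
  have h : |k| ≤ |k - a| + |k - a - b| + |k - b| := by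
    have := abs_add_three (k - a) (-(k - a - b)) (k - b)
    rw [abs_neg] at this
    rwa [show k - a + -(k - a - b) + (k - b) = k by ring] at this
  have h1 := abs_nonneg (k - a)
  have h2 := abs_nonneg (k - a - b)
  have h3 := abs_nonneg (k - b)
  grind

/-- The trilinear form with kernel `|a b|^{-1/2}` controlling the nonlinearity. -/
noncomputable def triConv (g : ℝ → ℝ) (k : ℝ) : ENNReal :=
  ∫⁻ a, ∫⁻ b, ENNReal.ofReal (√|a|)⁻¹ * ENNReal.ofReal (√|b|)⁻¹ *
    ENNReal.ofReal (g (k - a) * g (k - a - b) * g (k - b))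

theorem exists_triConv_le : ∃ C : ℝ, 0 < C ∧ ∀ (g : ℝ → ℝ) (μ n N : ℝ), (∀ x, 0 ≤ g x) →
    0 ≤ μ → 0 ≤ n → 0 ≤ N → (∀ x, g x ≤ N * decayWeight μ n x) →
    ∀ k, triConv g k ≤
      ENNReal.ofReal (C * N ^ 3 * ((√(1 + |k|))⁻¹ * decayWeight μ n k)) := by
  obtain ⟨C, hC, hΦ⟩ := exists_weightConv_inv_sqrt_le
  refine ⟨9 * C * C, by positivity, fun g μ n N hg hμ hn hN h k ↦ ?_⟩
  have hΦ' : ∀ k, weightConv (fun a ↦ ENNReal.ofReal (√|a|)⁻¹) k ≤ ENNReal.ofReal C := fun k ↦ by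
    refine (hΦ k).trans (ENNReal.ofReal_le_ofReal ?_)
    refine mul_le_of_le_one_right hC.le (inv_le_one_of_one_le₀ ?_)
    rw [Real.one_le_sqrt]
    linarith [abs_nonneg k]
  have key := lintegral_lintegral_prod_weight_le
    (κ := fun a ↦ ENNReal.ofReal (√|a|)⁻¹) (by fun_prop) hΦ' k
  set c : ℝ := N ^ 3 * Real.exp (-(μ * min |k| n)) with hc
  have hc0 : 0 ≤ c := by positivity
  have hpt : ∀ a b, ENNReal.ofReal (g (k - a) * g (k - a - b) * g (k - b)) ≤
      ENNReal.ofReal c * ENNReal.ofReal (((1 + |k - a|) ^ 2)⁻¹ *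
        ((1 + |k - a - b|) ^ 2)⁻¹ * ((1 + |k - b|) ^ 2)⁻¹) := by
    intro a b
    rw [← ENNReal.ofReal_mul hc0]
    refine ENNReal.ofReal_le_ofReal ?_
    have h1 := h (k - a)
    have h2 := h (k - a - b)
    have h3 := h (k - b)
    calc _ ≤ (N * decayWeight μ n (k - a)) * (N * decayWeight μ n (k - a - b)) *
          (N * decayWeight μ n (k - b)) := by
          have := hg (k - a)
          have := hg (k - b)
          have := hg (k - a - b)
          have := (decayWeight_pos μ n (k - a)).le
          have := (decayWeight_pos μ n (k - a - b)).le
          gcongr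
      _ = N ^ 3 * Real.exp (-(μ * (min |k - a| n + min |k - a - b| n + min |k - b| n))) *
          (((1 + |k - a|) ^ 2)⁻¹ * ((1 + |k - a - b|) ^ 2)⁻¹ * ((1 + |k - b|) ^ 2)⁻¹) := by
          simp only [decayWeight]
          rw [mul_add, mul_add, neg_add, neg_add, Real.exp_add, Real.exp_add]
          ring
      _ ≤ _ := by
          rw [hc]
          gcongr
          exact min_abs_add_three_le hn k a b
  unfold triConv
  calc _ ≤ ∫⁻ a, ∫⁻ b, ENNReal.ofReal c * (ENNReal.ofReal (√|a|)⁻¹ * ENNReal.ofReal (√|b|)⁻¹ *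
        ENNReal.ofReal (((1 + |k - a|) ^ 2)⁻¹ *
        ((1 + |k - a - b|) ^ 2)⁻¹ * ((1 + |k - b|) ^ 2)⁻¹)) := by
        refine lintegral_mono fun a ↦ lintegral_mono fun b ↦ ?_
        rw [mul_left_comm]
        gcongr
        exact hpt a b
    _ = ENNReal.ofReal c * ∫⁻ a, ∫⁻ b, (ENNReal.ofReal (√|a|)⁻¹ * ENNReal.ofReal (√|b|)⁻¹ *
        ENNReal.ofReal (((1 + |k - a|) ^ 2)⁻¹ *
        ((1 + |k - a - b|) ^ 2)⁻¹ * ((1 + |k - b|) ^ 2)⁻¹)) := by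
        simp_rw [lintegral_const_mul' _ _ ENNReal.ofReal_ne_top]
    _ ≤ ENNReal.ofReal c * (9 * ENNReal.ofReal C * ENNReal.ofReal (((1 + |k|) ^ 2)⁻¹) *
        ENNReal.ofReal (C * (√(1 + |k|))⁻¹)) := by
        gcongr
        refine key.trans ?_
        gcongr
        exact hΦ k
    _ = _ := by
        rw [show (9 : ENNReal) = ENNReal.ofReal 9 by simp, ← ENNReal.ofReal_mul (by positivity),
          ← ENNReal.ofReal_mul (by positivity), ← ENNReal.ofReal_mul (by positivity),
          ← ENNReal.ofReal_mul (by positivity), hc]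
        congr 1
        simp only [decayWeight]
        ring

theorem exp_decay_of_bootstrap {g : ℝ → ℝ} {A μ₀ C : ℝ} (hA : 0 < A)
    (hμ₀ : 0 < μ₀) (hC : 0 < C) (h0 : ∀ x, g x ≤ A * ((1 + |x|) ^ 2)⁻¹)
    (hb : ∀ μ, 0 ≤ μ → μ ≤ μ₀ → ∀ n N : ℝ, 0 ≤ n → 0 ≤ N →
      (∀ x, g x ≤ N * decayWeight μ n x) →
      ∀ x, g x ≤ C * N ^ 3 * ((√(1 + |x|))⁻¹ * decayWeight μ n x)) :
    ∃ K > 0, ∃ μ > 0, ∀ x, g x ≤ K * Real.exp (-μ * |x|) := by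
  set N := A * Real.exp 1 with hN
  have hN0 : 0 < N := by positivity
  set R := (8 * C * N ^ 2) ^ 2 with hR
  have hR0 : 0 ≤ R := by positivity
  set μ := min (min μ₀ (1 / (R + 1))) (Real.log 2) with hμ
  have hμ0 : 0 < μ := lt_min (lt_min hμ₀ (by positivity)) (Real.log_pos (by norm_num))
  have hμ1 : μ ≤ μ₀ := (min_le_left _ _).trans (min_le_left _ _)
  have hμR : μ * R ≤ 1 := by
    have h1 : μ ≤ 1 / (R + 1) := (min_le_left _ _).trans (min_le_right _ _)
    calc μ * R ≤ 1 / (R + 1) * (R + 1) := by gcongr; linarith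
      _ = 1 := by field_simp
  have hμ2 : Real.exp μ ≤ 2 := by
    rw [← Real.exp_log (show (0:ℝ) < 2 by norm_num)]
    exact Real.exp_le_exp.2 (min_le_right _ _)
  have hstep : ∀ n : ℕ, ∀ x, g x ≤ N * decayWeight μ n x := by
    intro n
    induction n with
    | zero =>
      intro x
      refine (h0 x).trans ?_
      simp only [decayWeight, Nat.cast_zero, min_eq_right (abs_nonneg x), mul_zero, neg_zero,
        Real.exp_zero, mul_one]
      gcongr
      rw [hN]
      exact le_mul_of_one_le_right hA.le (Real.one_le_exp zero_le_one)
    | succ n ih =>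
      have h1 : ∀ x, g x ≤ (2 * N) * decayWeight μ (n + 1 : ℕ) x := by
        intro x
        refine (ih x).trans ?_
        have : decayWeight μ n x ≤ 2 * decayWeight μ (n + 1 : ℕ) x := by
          simp only [decayWeight]
          rw [mul_left_comm]
          gcongr
          calc _ ≤ Real.exp (μ + -(μ * min |x| (n + 1 : ℕ))) := by
                refine Real.exp_le_exp.2 ?_
                have : min |x| ((n + 1 : ℕ) : ℝ) ≤ min |x| n + 1 := by
                  push_cast
                  rw [← min_add_add_right]
                  exact min_le_min (by linarith) le_rfl
                nlinarith
            _ ≤ _ := by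
                rw [Real.exp_add]
                gcongr
        nlinarith
      intro x
      rcases le_total |x| R with hx | hx
      · refine (h0 x).trans ?_
        simp only [decayWeight]
        rw [mul_left_comm, mul_comm A]
        gcongr
        rw [hN, mul_assoc, ← Real.exp_add]
        refine le_mul_of_one_le_right hA.le (Real.one_le_exp ?_)
        have : μ * min |x| ((n + 1 : ℕ) : ℝ) ≤ μ * R := by
          gcongr
          exact (min_le_left _ _).trans hx
        linarith
      · refine (hb μ hμ0.le hμ1 _ (2 * N) (by positivity) (by positivity) h1 x).trans ?_
        rw [← mul_assoc]
        refine mul_le_mul_of_nonneg_right ?_ (decayWeight_pos _ _ _).le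
        rw [← div_eq_mul_inv, div_le_iff₀ (Real.sqrt_pos.2 (by positivity))]
        have h2 : 8 * C * N ^ 2 ≤ √(1 + |x|) := by
          refine Real.le_sqrt_of_sq_le ?_
          linarith
        calc C * (2 * N) ^ 3 = N * (8 * C * N ^ 2) := by ring
          _ ≤ _ := by gcongr
  refine ⟨N, hN0, μ, hμ0, fun x ↦ ?_⟩
  obtain ⟨n, hn⟩ := exists_nat_ge |x|
  refine (hstep n x).trans ?_
  simp only [decayWeight, min_eq_left hn]
  gcongr
  rw [neg_mul]
  refine mul_le_of_le_one_left (Real.exp_pos _).le (inv_le_one_of_one_le₀ ?_)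
  exact one_le_pow₀ (by linarith [abs_nonneg x])

theorem norm_le_of_add_deriv_le {κ Cs P B : ℝ} (hκ : 0 < κ) {V : ℝ → ℝ}
    (hV : ∀ x y, V y ≤ Cs * Real.exp (κ / 2 * |x - y|) * V x) (hP : 0 ≤ P)
    {u u' : ℝ → ℂ} (hu : ∀ x, HasDerivAt u (u' x) x) (hu' : Continuous u')
    (hB : ∀ x, ‖u x‖ ≤ B) (h : ∀ x, ‖(κ : ℂ) * u x + u' x‖ ≤ P * V x) (x : ℝ) :
    ‖u x‖ ≤ P * (2 * Cs / κ) * V x := by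
  have hd : ∀ y, HasDerivAt (fun y : ℝ ↦ (Real.exp (κ * y) : ℂ) * u y)
      ((Real.exp (κ * y) : ℂ) * ((κ : ℂ) * u y + u' y)) y := by
    intro y
    have h1 : HasDerivAt (fun y : ℝ ↦ (Real.exp (κ * y) : ℂ)) ((Real.exp (κ * y) * κ : ℝ) : ℂ) y := by
      have := ((hasDerivAt_id y).const_mul κ).exp.ofReal_comp
      simpa using this
    convert! h1.mul (hu y) using 1
    push_cast
    ring
  have huc : Continuous u := continuous_iff_continuousAt.2 fun y ↦ (hu y).continuousAt
  have hE : ∀ z ≤ x, ‖(Real.exp (κ * x) : ℂ) * u x - (Real.exp (κ * z) : ℂ) * u z‖ ≤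
      P * Cs * V x * (2 / κ) * Real.exp (κ * x) := by
    intro z hz
    rw [← intervalIntegral.integral_eq_sub_of_hasDerivAt (fun y _ ↦ hd y)
      (Continuous.intervalIntegrable (by fun_prop) _ _)]
    have h2 : ∀ y ∈ Icc z x, ‖(Real.exp (κ * y) : ℂ) * ((κ : ℂ) * u y + u' y)‖ ≤
        P * Cs * V x * Real.exp (κ / 2 * x) * Real.exp (κ / 2 * y) := by
      intro y hy
      rw [norm_mul, Complex.norm_real, Real.norm_eq_abs, abs_of_pos (Real.exp_pos _)]
      calc _ ≤ Real.exp (κ * y) * (P * (Cs * Real.exp (κ / 2 * |x - y|) * V x)) := by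
            gcongr
            exact (h y).trans (by gcongr; exact hV x y)
        _ = P * Cs * V x * (Real.exp (κ * y) * Real.exp (κ / 2 * |x - y|)) := by ring
        _ = _ := by
            rw [abs_of_nonneg (by linarith [hy.2]), mul_assoc _ (Real.exp _) (Real.exp _),
              ← Real.exp_add, ← Real.exp_add]
            congr 2
            ring
    have h3 : ∫ y in z..x, P * Cs * V x * Real.exp (κ / 2 * x) * Real.exp (κ / 2 * y) =
        P * Cs * V x * Real.exp (κ / 2 * x) *
          (2 / κ * (Real.exp (κ / 2 * x) - Real.exp (κ / 2 * z))) := by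
      rw [intervalIntegral.integral_const_mul]
      congr 1
      have : ∀ y ∈ uIcc z x, HasDerivAt (fun y ↦ 2 / κ * Real.exp (κ / 2 * y))
          (Real.exp (κ / 2 * y)) y := fun y _ ↦ by
        have := ((hasDerivAt_id y).const_mul (κ / 2)).exp.const_mul (2 / κ)
        convert! this using 1
        simp only [id]
        field_simp
      rw [intervalIntegral.integral_eq_sub_of_hasDerivAt this
        (Continuous.intervalIntegrable (by fun_prop) _ _), mul_sub]
    have hnn : 0 ≤ P * Cs * V x := by
      have h5 := (norm_nonneg _).trans (h x)
      have h6 := hV x x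
      simp only [sub_self, abs_zero, mul_zero, Real.exp_zero, mul_one] at h6
      calc 0 ≤ P * V x := h5
        _ ≤ P * (Cs * V x) := by gcongr
        _ = _ := by ring
    refine (intervalIntegral.norm_integral_le_of_norm_le hz
      (ae_of_all _ fun y hy ↦ h2 y (Ioc_subset_Icc_self hy))
      (Continuous.intervalIntegrable (by fun_prop) _ _)).trans ?_
    rw [h3]
    have h7 : Real.exp (κ * x) = Real.exp (κ / 2 * x) * Real.exp (κ / 2 * x) := by
      rw [← Real.exp_add]
      congr 1
      ring
    rw [h7]
    have h8 := Real.exp_pos (κ / 2 * z)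
    calc _ ≤ P * Cs * V x * Real.exp (κ / 2 * x) * (2 / κ * Real.exp (κ / 2 * x)) := by
          gcongr
          linarith
      _ = _ := by ring
  have hlim : Tendsto (fun z : ℝ ↦ ‖(Real.exp (κ * x) : ℂ) * u x - (Real.exp (κ * z) : ℂ) * u z‖)
      atBot (𝓝 ‖(Real.exp (κ * x) : ℂ) * u x - 0‖) := by
    refine (tendsto_const_nhds.sub ?_).norm
    have h9 : Tendsto (fun z ↦ Real.exp (κ * z) * B) atBot (𝓝 0) := by
      have := (Real.tendsto_exp_atBot.comp (tendsto_id.const_mul_atBot hκ)).mul_const B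
      simpa using this
    refine squeeze_zero_norm (fun z ↦ ?_) h9
    rw [norm_mul, Complex.norm_real, Real.norm_eq_abs, abs_of_pos (Real.exp_pos _)]
    gcongr
    exact hB z
  have hfin := le_of_tendsto hlim ((eventually_le_atBot x).mono fun z hz ↦ hE z hz)
  rw [sub_zero, norm_mul, Complex.norm_real, Real.norm_eq_abs, abs_of_pos (Real.exp_pos _),
    mul_comm] at hfin
  have := le_of_mul_le_mul_right hfin (Real.exp_pos _)
  calc _ ≤ _ := this
    _ = _ := by ring

theorem norm_le_of_resolvent_le {κ Cs P B : ℝ} (hκ : 0 < κ) {V : ℝ → ℝ}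
    (hV : ∀ x y, V y ≤ Cs * Real.exp (κ / 2 * |x - y|) * V x) (hP : 0 ≤ P) (hCs : 0 ≤ Cs)
    {u u' u'' : ℝ → ℂ} (hu : ∀ x, HasDerivAt u (u' x) x) (hu' : ∀ x, HasDerivAt u' (u'' x) x)
    (hu'' : Continuous u'') (hB : ∀ x, ‖u x‖ ≤ B) (hB' : ∀ x, ‖u' x‖ ≤ B)
    (h : ∀ x, ‖(κ : ℂ) ^ 2 * u x - u'' x‖ ≤ P * V x) (x : ℝ) :
    ‖u x‖ ≤ P * (2 * Cs / κ) ^ 2 * V x := by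
  have huc : Continuous u' := continuous_iff_continuousAt.2 fun y ↦ (hu' y).continuousAt
  have h1 : ∀ x, ‖(κ : ℂ) * u x + u' x‖ ≤ P * (2 * Cs / κ) * V x := by
    intro x
    have := norm_le_of_add_deriv_le (u := fun y ↦ (κ : ℂ) * u (-y) + u' (-y))
      (u' := fun y ↦ -((κ : ℂ) * u' (-y) + u'' (-y))) (V := fun y ↦ V (-y)) (B := κ * B + B)
      (P := P) (Cs := Cs) hκ
      (fun x y ↦ by
        have := hV (-x) (-y)
        rwa [show |-x - -y| = |x - y| by rw [← abs_neg]; congr 1; ring] at this) hP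
      (fun y ↦ by
        have h2 := (((hu (-y)).const_mul (κ : ℂ)).add (hu' (-y))).scomp y (hasDerivAt_neg y)
        convert! h2 using 1
        rw [neg_smul, one_smul])
      (by fun_prop)
      (fun y ↦ by
        refine (norm_add_le _ _).trans ?_
        rw [norm_mul, Complex.norm_real, Real.norm_eq_abs, abs_of_pos hκ]
        gcongr
        · exact hB _
        · exact hB' _)
      (fun y ↦ by
        convert h (-y) using 2
        ring) (-x)
    simpa using this
  have := norm_le_of_add_deriv_le hκ hV (P := P * (2 * Cs / κ)) (by positivity) hu huc hB h1 x
  refine this.trans (le_of_eq ?_)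
  ring

theorem exists_weight_le_exp_mul {κ : ℝ} (hκ : 0 < κ) : ∃ Cs : ℝ, 0 < Cs ∧
    ∀ μ n : ℝ, 0 ≤ μ → μ ≤ κ / 4 → ∀ x y,
      (√(1 + |y|))⁻¹ * decayWeight μ n y ≤
        Cs * Real.exp (κ / 2 * |x - y|) * ((√(1 + |x|))⁻¹ * decayWeight μ n x) := by
  set c := κ / 12 with hc
  have hc0 : 0 < c := by positivity
  refine ⟨(1 + c⁻¹) ^ 3, by positivity, fun μ n hμ hμκ x y ↦ ?_⟩
  set t := |x - y| with ht
  have ht0 : 0 ≤ t := abs_nonneg _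
  have hxy : |x| ≤ |y| + t := by
    have := abs_add_le y (x - y)
    rwa [add_sub_cancel] at this
  have hp : 1 + |x| ≤ (1 + |y|) * (1 + t) := by nlinarith [abs_nonneg y]
  have h1 : (1 + t) ^ 3 ≤ (1 + c⁻¹) ^ 3 * Real.exp (κ / 4 * t) := by
    have h2 : 1 + t ≤ (1 + c⁻¹) * Real.exp (c * t) := by
      calc 1 + t ≤ (1 + c⁻¹) * (c * t + 1) := by
            have : c⁻¹ * (c * t) = t := by field_simp
            have := mul_nonneg hc0.le ht0
            have := inv_pos.2 hc0
            nlinarith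
        _ ≤ _ := by
            gcongr
            exact Real.add_one_le_exp _
    calc (1 + t) ^ 3 ≤ ((1 + c⁻¹) * Real.exp (c * t)) ^ 3 := by gcongr
      _ = _ := by
        rw [mul_pow, ← Real.exp_nat_mul]
        congr 2
        rw [hc]
        push_cast
        ring
  have h3 : (√(1 + |y|))⁻¹ * ((1 + |y|) ^ 2)⁻¹ ≤
      (1 + t) ^ 3 * ((√(1 + |x|))⁻¹ * ((1 + |x|) ^ 2)⁻¹) := by
    have hs : √(1 + |x|) ≤ √(1 + |y|) * (1 + t) := by
      calc √(1 + |x|) ≤ √((1 + |y|) * (1 + t)) := Real.sqrt_le_sqrt hp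
        _ = √(1 + |y|) * √(1 + t) := Real.sqrt_mul (by positivity) _
        _ ≤ _ := by
          gcongr
          rw [Real.sqrt_le_left (by positivity)]
          nlinarith
    have hq : (1 + |x|) ^ 2 ≤ (1 + |y|) ^ 2 * (1 + t) ^ 2 := by
      rw [← mul_pow]
      gcongr
    rw [← mul_inv, ← mul_inv, ← div_eq_mul_inv, inv_le_iff_one_le_mul₀ (by positivity),
      div_mul_eq_mul_div, le_div_iff₀ (by positivity), one_mul]
    calc _ ≤ (√(1 + |y|) * (1 + t)) * ((1 + |y|) ^ 2 * (1 + t) ^ 2) := by gcongr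
      _ = _ := by ring
  have h4 : Real.exp (-(μ * min |y| n)) ≤ Real.exp (κ / 4 * t) * Real.exp (-(μ * min |x| n)) := by
    rw [← Real.exp_add]
    refine Real.exp_le_exp.2 ?_
    have h5 : min |x| n ≤ min |y| n + t := by
      rw [← min_add_add_right]
      exact min_le_min hxy (by linarith)
    nlinarith
  simp only [decayWeight]
  rw [← mul_assoc, ← mul_assoc]
  calc _ ≤ ((1 + t) ^ 3 * ((√(1 + |x|))⁻¹ * ((1 + |x|) ^ 2)⁻¹)) *
        (Real.exp (κ / 4 * t) * Real.exp (-(μ * min |x| n))) := by gcongr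
    _ ≤ (((1 + c⁻¹) ^ 3 * Real.exp (κ / 4 * t)) * ((√(1 + |x|))⁻¹ * ((1 + |x|) ^ 2)⁻¹)) *
        (Real.exp (κ / 4 * t) * Real.exp (-(μ * min |x| n))) := by gcongr
    _ = (1 + c⁻¹) ^ 3 * (Real.exp (κ / 4 * t) * Real.exp (κ / 4 * t)) *
        ((√(1 + |x|))⁻¹ * ((1 + |x|) ^ 2)⁻¹) * Real.exp (-(μ * min |x| n)) := by ring
    _ = _ := by
        rw [← Real.exp_add, show κ / 4 * t + κ / 4 * t = κ / 2 * t by ring]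
        ring

theorem norm_cexp_I_mul_mul (k x : ℝ) : ‖Complex.exp (Complex.I * k * x)‖ = 1 := by
  rw [mul_assoc, mul_comm, ← Complex.ofReal_mul, Complex.norm_exp_ofReal_mul_I]

theorem ft_eq_fourier (g : ℝ → ℂ) (k : ℝ) :
    ft g k = ((√(2 * Real.pi) : ℝ) : ℂ)⁻¹ * 𝓕 g (-(k / (2 * Real.pi))) := by
  rw [ft, Real.fourier_real_eq_integral_exp_smul]
  congr 2
  ext x
  rw [smul_eq_mul]
  congr 2
  push_cast
  field_simp

theorem norm_ft_le (g : ℝ → ℂ) (k : ℝ) : ‖ft g k‖ ≤ (√(2 * Real.pi))⁻¹ * ∫ x, ‖g x‖ := by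
  rw [ft, norm_mul, norm_inv, Complex.norm_real, Real.norm_eq_abs,
    abs_of_nonneg (Real.sqrt_nonneg _)]
  gcongr
  refine (norm_integral_le_integral_norm _).trans (le_of_eq ?_)
  refine integral_congr_ae (Eventually.of_forall fun x ↦ ?_)
  simp only [norm_mul, norm_cexp_I_mul_mul, one_mul]

theorem continuous_ft {g : ℝ → ℂ} (hg : Integrable g) : Continuous (ft g) := by
  unfold ft
  refine continuous_const.mul ?_
  refine continuous_of_dominated (bound := fun x ↦ ‖g x‖)
    (fun k ↦ (Continuous.aestronglyMeasurable (by fun_prop)).mul hg.1)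
    (fun k ↦ Eventually.of_forall fun x ↦ ?_) hg.norm (Eventually.of_forall fun x ↦ by fun_prop)
  rw [norm_mul, norm_cexp_I_mul_mul, one_mul]

theorem integrable_ft_iff {g : ℝ → ℂ} : Integrable (ft g) ↔ Integrable (𝓕 g) := by
  have hc : ((√(2 * Real.pi) : ℝ) : ℂ)⁻¹ ≠ 0 := by
    refine inv_ne_zero (Complex.ofReal_ne_zero.2 ?_)
    exact (Real.sqrt_pos.2 Real.two_pi_pos).ne'
  have h : ft g = fun k ↦ ((√(2 * Real.pi) : ℝ) : ℂ)⁻¹ • 𝓕 g (k * (-(2 * Real.pi)⁻¹)) := by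
    ext k
    rw [ft_eq_fourier, smul_eq_mul, mul_neg, div_eq_mul_inv]
  rw [h]
  have := integrable_fun_smul_iff (μ := volume) hc (fun k ↦ 𝓕 g (k * (-(2 * Real.pi)⁻¹)))
  rw [this]
  exact integrable_comp_mul_right_iff _ (neg_ne_zero.2 (inv_ne_zero Real.two_pi_pos.ne'))

theorem ft_ft_neg {g : ℝ → ℂ} (hc : Continuous g) (hg : Integrable g) (hg' : Integrable (ft g))
    (x : ℝ) : ft (ft g) (-x) = g x := by
  have h := hg.fourierInv_fourier_eq (integrable_ft_iff.1 hg') (hc.continuousAt (x := x))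
  rw [Real.fourierInv_eq_fourier_neg, Real.fourier_real_eq_integral_exp_smul] at h
  have hpi := Real.two_pi_pos
  have h1 : ∫ v : ℝ, Complex.exp (Complex.I * ((-x : ℝ) : ℂ) * v) *
      𝓕 g (-(v / (2 * Real.pi))) = (2 * Real.pi : ℝ) • g x := by
    rw [← h]
    have := Measure.integral_comp_mul_right (fun v : ℝ ↦
      Complex.exp (((-2 * Real.pi * v * (-x) : ℝ) : ℂ) * Complex.I) • 𝓕 g v)
      (-(2 * Real.pi)⁻¹)
    rw [inv_neg, inv_inv, abs_neg, abs_of_pos hpi] at this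
    rw [← this]
    congr 1
    ext v
    rw [smul_eq_mul, mul_neg v, ← div_eq_mul_inv]
    congr 2
    push_cast
    field_simp
  rw [ft]
  simp_rw [ft_eq_fourier g, mul_left_comm _ (((√(2 * Real.pi) : ℝ) : ℂ)⁻¹) _]
  rw [integral_const_mul, h1, ← mul_assoc, ← mul_inv, ← Complex.ofReal_mul,
    Real.mul_self_sqrt hpi.le, Complex.real_smul, inv_mul_cancel_left₀]
  exact_mod_cast hpi.ne'

theorem ft_comp_neg (g : ℝ → ℂ) (k : ℝ) : ft (fun x ↦ g (-x)) k = ft g (-k) := by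
  rw [ft, ft, ← integral_neg_eq_self]
  simp

theorem ft_ft_comp_neg {g : ℝ → ℂ} (hc : Continuous g) (hg : Integrable g)
    (hg' : Integrable (ft g)) : ft (fun x ↦ ft g (-x)) = g := by
  ext k
  rw [ft_comp_neg, ft_ft_neg hc hg hg']

theorem exists_schwartz_eq_ft (φ : 𝓢(ℝ, ℂ)) : ∃ ψ : 𝓢(ℝ, ℂ), ⇑ψ = ft φ := by
  have hpi := Real.two_pi_pos
  refine ⟨((√(2 * Real.pi) : ℝ) : ℂ)⁻¹ • SchwartzMap.compCLMOfContinuousLinearEquiv ℂ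
    (ContinuousLinearEquiv.smulLeft (Units.mk0 (-(2 * Real.pi)⁻¹)
      (neg_ne_zero.2 (inv_ne_zero hpi.ne')))) (𝓕 φ), ?_⟩
  ext k
  rw [ft_eq_fourier, smul_apply, SchwartzMap.compCLMOfContinuousLinearEquiv_apply,
    smul_eq_mul, SchwartzMap.fourier_coe, Function.comp_apply]
  have : -(2 * Real.pi)⁻¹ * k = -(k / (2 * Real.pi)) := by field_simp
  rw [← this]
  rfl

theorem hasTemperateGrowth_cexp_I_mul :
    (fun t : ℝ ↦ Complex.exp (Complex.I * t)).HasTemperateGrowth := by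
  refine ⟨(contDiff_const.mul Complex.ofRealCLM.contDiff).cexp, fun n ↦ ⟨0, 1, fun x ↦ ?_⟩⟩
  rw [norm_iteratedFDeriv_eq_norm_iteratedDeriv]
  have : iteratedDeriv n (fun t : ℝ ↦ Complex.exp (Complex.I * t)) =
      fun t : ℝ ↦ Complex.I ^ n * Complex.exp (Complex.I * t) := by
    induction n with
    | zero => simp
    | succ n ih =>
      rw [iteratedDeriv_succ, ih]
      ext t
      have : HasDerivAt (fun t : ℝ ↦ Complex.I ^ n * Complex.exp (Complex.I * t))
          (Complex.I ^ n * (Complex.exp (Complex.I * t) * (Complex.I * 1))) t :=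
        ((((hasDerivAt_id t).ofReal_comp).const_mul Complex.I).cexp).const_mul _
      rw [this.deriv]
      ring
  rw [this]
  simp [Complex.norm_exp]

theorem exists_schwartz_eq_chirp_mul (r : ℝ) (φ : 𝓢(ℝ, ℂ)) :
    ∃ ψ : 𝓢(ℝ, ℂ), ⇑ψ = fun k ↦ Complex.exp (Complex.I * ((r * k ^ 2 : ℝ) : ℂ)) * φ k := by
  have h : (fun k : ℝ ↦ Complex.exp (Complex.I * ((r * k ^ 2 : ℝ) : ℂ))).HasTemperateGrowth := by
    have h2 : (fun k : ℝ ↦ r * k ^ 2).HasTemperateGrowth :=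
      (Function.HasTemperateGrowth.const r).mul (Function.HasTemperateGrowth.id'.pow 2)
    exact hasTemperateGrowth_cexp_I_mul.comp h2
  refine ⟨SchwartzMap.smulLeftCLM ℂ
    (fun k : ℝ ↦ Complex.exp (Complex.I * ((r * k ^ 2 : ℝ) : ℂ))) φ, ?_⟩
  rw [SchwartzMap.smulLeftCLM_apply h]
  rfl

theorem integrable_ft_schwartz (φ : 𝓢(ℝ, ℂ)) : Integrable (ft φ) := by
  obtain ⟨ψ, hψ⟩ := exists_schwartz_eq_ft φ
  rw [← hψ]
  exact ψ.integrable

theorem ft_deriv_deriv (φ : 𝓢(ℝ, ℂ)) (k : ℝ) :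
    ft (deriv (deriv φ)) k = -((k ^ 2 : ℝ) : ℂ) * ft φ k := by
  have h1 : (SchwartzMap.derivCLM ℂ ℂ φ : ℝ → ℂ) = deriv φ := by
    ext x
    simp
  have h2 : (SchwartzMap.derivCLM ℂ ℂ (SchwartzMap.derivCLM ℂ ℂ φ) : ℝ → ℂ) =
      deriv (deriv φ) := by
    ext x
    simp [h1]
  have hd1 : Integrable (deriv φ) := h1 ▸ (SchwartzMap.derivCLM ℂ ℂ φ).integrable
  have hd2 : Integrable (deriv (deriv φ)) := h2 ▸
    (SchwartzMap.derivCLM ℂ ℂ (SchwartzMap.derivCLM ℂ ℂ φ)).integrable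
  have hpi := Real.two_pi_pos
  have hpi' : (Real.pi : ℂ) ≠ 0 := by exact_mod_cast Real.pi_ne_zero
  rw [ft_eq_fourier, ft_eq_fourier, Real.fourier_deriv hd1 (h1 ▸
    (SchwartzMap.derivCLM ℂ ℂ φ).differentiable) hd2,
    Real.fourier_deriv φ.integrable φ.differentiable hd1]
  simp only [smul_eq_mul]
  push_cast
  field_simp
  rw [Complex.I_sq]
  ring

/-- The integrand of the cubic nonlinearity on the Fourier side. -/
noncomputable def tri (φ : ℝ → ℂ) (k : ℝ) (z : ℝ × ℝ) : ℂ :=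
  φ (k - z.1) * (starRingEnd ℂ) (φ (k - z.1 - z.2)) * φ (k - z.2)

theorem norm_tri (φ : ℝ → ℂ) (k : ℝ) (z : ℝ × ℝ) :
    ‖tri φ k z‖ = ‖φ (k - z.1)‖ * ‖φ (k - z.1 - z.2)‖ * ‖φ (k - z.2)‖ := by
  simp [tri]

theorem continuous_tri {φ : ℝ → ℂ} (hφ : Continuous φ) :
    Continuous fun q : ℝ × ℝ × ℝ ↦ tri φ q.1 q.2 := by
  unfold tri
  fun_prop

theorem continuous_tri_right {φ : ℝ → ℂ} (hφ : Continuous φ) (k : ℝ) : Continuous (tri φ k) :=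
  (continuous_tri hφ).comp (Continuous.prodMk_right k)

theorem exists_integral_norm_tri_le : ∃ C : ℝ, 0 < C ∧ ∀ (φ : ℝ → ℂ) (A : ℝ), Continuous φ →
    0 ≤ A → (∀ x, ‖φ x‖ ≤ A * ((1 + |x|) ^ 2)⁻¹) → ∀ k, Integrable (tri φ k) ∧
      ∫ z, ‖tri φ k z‖ ≤ C * A ^ 3 * ((1 + |k|) ^ 2)⁻¹ := by
  obtain ⟨C, hC, hΦ⟩ := exists_weightConv_one_le
  refine ⟨9 * C * C, by positivity, fun φ A hφ hA h k ↦ ?_⟩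
  have key := lintegral_lintegral_prod_weight_le (κ := fun _ ↦ 1) measurable_const hΦ k
  have hm := continuous_tri_right hφ k
  have hlin : ∫⁻ z, ‖tri φ k z‖ₑ ≤ ENNReal.ofReal (9 * C * C * A ^ 3 * ((1 + |k|) ^ 2)⁻¹) := by
    rw [Measure.volume_eq_prod, lintegral_prod _ hm.measurable.enorm.aemeasurable]
    have hA3 : 0 ≤ A ^ 3 := by positivity
    calc _ ≤ ∫⁻ a, ∫⁻ b, ENNReal.ofReal (A ^ 3) * (1 * 1 * ENNReal.ofReal (((1 + |k - a|) ^ 2)⁻¹ *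
            ((1 + |k - a - b|) ^ 2)⁻¹ * ((1 + |k - b|) ^ 2)⁻¹)) := by
          refine lintegral_mono fun a ↦ lintegral_mono fun b ↦ ?_
          rw [one_mul, one_mul, ← ENNReal.ofReal_mul hA3, ← ofReal_norm, norm_tri]
          refine ENNReal.ofReal_le_ofReal ?_
          calc _ ≤ (A * ((1 + |k - a|) ^ 2)⁻¹) * (A * ((1 + |k - a - b|) ^ 2)⁻¹) *
                (A * ((1 + |k - b|) ^ 2)⁻¹) := by
                gcongr
                · exact h _
                · exact h _
                · exact h _
            _ = _ := by ring
      _ = ENNReal.ofReal (A ^ 3) * ∫⁻ a, ∫⁻ b, (1 * 1 * ENNReal.ofReal (((1 + |k - a|) ^ 2)⁻¹ *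
            ((1 + |k - a - b|) ^ 2)⁻¹ * ((1 + |k - b|) ^ 2)⁻¹)) := by
          simp_rw [lintegral_const_mul' _ _ ENNReal.ofReal_ne_top]
      _ ≤ ENNReal.ofReal (A ^ 3) * (9 * ENNReal.ofReal C * ENNReal.ofReal (((1 + |k|) ^ 2)⁻¹) *
            ENNReal.ofReal C) := by
          gcongr
          refine key.trans ?_
          gcongr
          exact hΦ k
      _ = _ := by
          rw [show (9 : ENNReal) = ENNReal.ofReal 9 by simp, ← ENNReal.ofReal_mul (by positivity),
            ← ENNReal.ofReal_mul (by positivity), ← ENNReal.ofReal_mul (by positivity),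
            ← ENNReal.ofReal_mul (by positivity)]
          congr 1
          ring
  have h_int : Integrable (tri φ k) :=
    ⟨hm.aestronglyMeasurable, hlin.trans_lt ENNReal.ofReal_lt_top⟩
  refine ⟨h_int, ?_⟩
  rw [integral_norm_eq_lintegral_enorm h_int.1]
  exact ENNReal.toReal_le_of_le_ofReal (by positivity) hlin

theorem ft_ft_comp_neg_mul {p w : ℝ → ℂ} (hp : Integrable p) (hw : Integrable w) (k : ℝ) :
    ft (fun x ↦ ft p (-x) * w x) k =
      ((√(2 * Real.pi) : ℝ) : ℂ)⁻¹ * ∫ l, p l * ft w (k - l) := by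
  set c : ℂ := ((√(2 * Real.pi) : ℝ) : ℂ)⁻¹ with hc
  have h1 : ∀ x : ℝ, Complex.exp (Complex.I * k * x) * (ft p (-x) * w x) =
      c * ∫ l : ℝ, Complex.exp (Complex.I * ((k - l : ℝ) : ℂ) * x) * (p l * w x) := by
    intro x
    rw [ft, ← hc, mul_assoc c, mul_left_comm, ← integral_mul_const, ← integral_const_mul]
    congr 2
    ext l
    rw [show Complex.I * ((k - l : ℝ) : ℂ) * x = Complex.I * k * x + Complex.I * ((-x : ℝ) : ℂ) * l
      by push_cast; ring, Complex.exp_add]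
    ring
  have h_int : Integrable (Function.uncurry fun x l : ℝ ↦
      Complex.exp (Complex.I * ((k - l : ℝ) : ℂ) * x) * (p l * w x)) (volume.prod volume) := by
    have h2 : Integrable (fun q : ℝ × ℝ ↦ p q.2 * w q.1) (volume.prod volume) := by
      have := hw.mul_prod hp
      exact this.congr (Eventually.of_forall fun q ↦ mul_comm _ _)
    refine h2.bdd_mul (c := 1) (Continuous.aestronglyMeasurable (by fun_prop))
      (Eventually.of_forall fun q ↦ ?_)
    rw [norm_cexp_I_mul_mul]
  rw [ft, ← hc]
  simp_rw [h1]
  rw [integral_const_mul, integral_integral_swap h_int]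
  congr 1
  rw [← integral_const_mul]
  congr 1
  ext l
  rw [ft, ← hc]
  simp_rw [mul_left_comm _ (p l)]
  rw [integral_const_mul]
  ring

theorem conj_ft (p : ℝ → ℂ) (x : ℝ) :
    (starRingEnd ℂ) (ft p x) = ft (fun k ↦ (starRingEnd ℂ) (p k)) (-x) := by
  rw [ft, ft, map_mul, ← integral_conj]
  congr 1
  · simp
  · congr 1
    ext k
    rw [map_mul, ← Complex.exp_conj]
    simp

theorem ft_cubic {p : ℝ → ℂ} (hc : Continuous p) (hp : Integrable p) (hp' : Integrable (ft p))
    {k : ℝ} (htri : Integrable (tri p k)) :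
    ft (fun x ↦ ft p (-x) * (starRingEnd ℂ) (ft p (-x)) * ft p (-x)) k =
      ((2 * Real.pi : ℝ) : ℂ)⁻¹ * ∫ z, tri p k z := by
  have hpi := Real.two_pi_pos
  have hu : Integrable fun x ↦ ft p (-x) := hp'.comp_neg
  set q : ℝ → ℂ := fun l ↦ (starRingEnd ℂ) (p (-l)) with hq
  have hpc : Integrable fun l ↦ (starRingEnd ℂ) (p l) :=
    (Complex.conjLIE.integrable_comp_iff (φ := p)).2 hp
  have hqi : Integrable q := hpc.comp_neg
  have hconj : ∀ x, (starRingEnd ℂ) (ft p (-x)) = ft q (-x) := by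
    intro x
    rw [conj_ft, neg_neg, hq, ft_comp_neg (fun l ↦ (starRingEnd ℂ) (p l)), neg_neg]
  have hqu : Integrable fun x ↦ ft q (-x) * ft p (-x) := by
    refine hu.bdd_mul (c := (√(2 * Real.pi))⁻¹ * ∫ x, ‖q x‖)
      ((continuous_ft hqi).comp continuous_neg).aestronglyMeasurable
      (Eventually.of_forall fun x ↦ norm_ft_le _ _)
  simp_rw [hconj, mul_assoc]
  rw [ft_ft_comp_neg_mul hp hqu]
  simp_rw [ft_ft_comp_neg_mul hqi hu, ft_ft_comp_neg hc hp hp']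
  rw [Measure.volume_eq_prod] at htri ⊢
  rw [integral_prod _ htri]
  rw [← integral_sub_left_eq_self _ volume k]
  have h2 : ∀ a, p (k - a) * (((√(2 * Real.pi) : ℝ) : ℂ)⁻¹ * ∫ l, q l * p (k - (k - a) - l)) =
      ((√(2 * Real.pi) : ℝ) : ℂ)⁻¹ * ∫ b, tri p k (a, b) := by
    intro a
    rw [← integral_sub_right_eq_self _ (k - a), mul_left_comm, ← integral_const_mul]
    congr 2
    ext b
    simp only [tri, hq]
    rw [show -(b - (k - a)) = k - a - b by ring, show k - (k - a) - (b - (k - a)) = k - b by ring]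
    ring
  simp_rw [h2]
  rw [integral_const_mul, ← mul_assoc, ← mul_inv, ← Complex.ofReal_mul,
    Real.mul_self_sqrt hpi.le]

theorem tri_chirp_mul (r : ℝ) (φ : ℝ → ℂ) (k : ℝ) (z : ℝ × ℝ) :
    tri (fun k ↦ Complex.exp (Complex.I * ((r * k ^ 2 : ℝ) : ℂ)) * φ k) k z =
      Complex.exp (Complex.I * ((r * k ^ 2 : ℝ) : ℂ)) *
        (tri φ k z * Complex.exp (-(2 * r * (z.1 * z.2) : ℝ) * Complex.I)) := by
  simp only [tri, map_mul, ← Complex.exp_conj]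
  simp only [Complex.conj_I, Complex.conj_ofReal]
  have h : Complex.exp (Complex.I * ((r * k ^ 2 : ℝ) : ℂ)) *
      Complex.exp (-(2 * r * (z.1 * z.2) : ℝ) * Complex.I) =
      Complex.exp (Complex.I * ((r * (k - z.1) ^ 2 : ℝ) : ℂ)) *
      Complex.exp (-Complex.I * ((r * (k - z.1 - z.2) ^ 2 : ℝ) : ℂ)) *
      Complex.exp (Complex.I * ((r * (k - z.2) ^ 2 : ℝ) : ℂ)) := by
    rw [← Complex.exp_add, ← Complex.exp_add, ← Complex.exp_add]
    congr 1
    push_cast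
    ring
  linear_combination (-φ (k - z.1) * (starRingEnd ℂ) (φ (k - z.1 - z.2)) * φ (k - z.2)) * h

theorem ofReal_norm_integral_tri_le {φ : ℝ → ℂ} {k : ℝ}
    (htri : Integrable (tri φ k)) {θ : ℝ → ℝ × ℝ → ℂ} (hθ : Measurable (Function.uncurry θ))
    {B : ℝ} (hB : ∀ v z, ‖θ v z‖ ≤ B) {E : ℝ → ℝ} (hE : Continuous E) {L M : ℝ} (hL : 0 ≤ L)
    (hM : 0 ≤ M)
    (h : ∀ z : ℝ × ℝ, z.1 ≠ 0 → z.2 ≠ 0 →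
      ‖∫ s in (0:ℝ)..L, θ (E s) z‖ ≤ M * ((√|z.1|)⁻¹ * (√|z.2|)⁻¹)) :
    ENNReal.ofReal ‖∫ s in (0:ℝ)..L, ∫ z, tri φ k z * θ (E s) z‖ ≤
      ENNReal.ofReal M * triConv (fun x ↦ ‖φ x‖) k := by
  have hθE : Measurable fun q : ℝ × ℝ × ℝ ↦ θ (E q.1) q.2 :=
    hθ.comp ((hE.measurable.comp measurable_fst).prodMk measurable_snd)
  have h_int : Integrable (Function.uncurry fun s z ↦ tri φ k z * θ (E s) z)
      ((volume.restrict (Ioc 0 L)).prod volume) := by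
    have h1 : Integrable (fun q : ℝ × ℝ × ℝ ↦ tri φ k q.2)
        ((volume.restrict (Ioc 0 L)).prod volume) := htri.comp_snd _
    refine h1.mul_bdd (c := B) hθE.aestronglyMeasurable (Eventually.of_forall fun q ↦ hB _ _)
  rw [intervalIntegral.integral_of_le hL, integral_integral_swap h_int, ofReal_norm]
  refine (enorm_integral_le_lintegral_enorm _).trans ?_
  have hm : AEStronglyMeasurable (fun z ↦ ∫ s in Ioc 0 L, tri φ k z * θ (E s) z) volume :=
    h_int.integral_prod_right.1
  rw [Measure.volume_eq_prod] at hm ⊢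
  rw [lintegral_prod _ hm.enorm]
  unfold triConv
  rw [← lintegral_const_mul' _ _ ENNReal.ofReal_ne_top]
  have h0 : ∀ᵐ a : ℝ, a ≠ 0 := by
    simp [ae_iff]
  refine lintegral_mono_ae (h0.mono fun a ha ↦ ?_)
  rw [← lintegral_const_mul' _ _ ENNReal.ofReal_ne_top]
  refine lintegral_mono_ae (h0.mono fun b hb ↦ ?_)
  rw [integral_const_mul, ← ofReal_norm, ← ENNReal.ofReal_mul (by positivity),
    ← ENNReal.ofReal_mul (by positivity), ← ENNReal.ofReal_mul (by positivity)]
  refine ENNReal.ofReal_le_ofReal ?_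
  rw [norm_mul, norm_tri]
  have := h (a, b) ha hb
  rw [intervalIntegral.integral_of_le hL] at this
  calc _ ≤ ‖φ (k - a)‖ * ‖φ (k - a - b)‖ * ‖φ (k - b)‖ * (M * ((√|a|)⁻¹ * (√|b|)⁻¹)) := by
        gcongr
    _ = _ := by ring

theorem tevol_eq_ft (r : ℝ) (g : ℝ → ℂ) (x : ℝ) :
    Tevol r g x = ft (fun k ↦ Complex.exp (Complex.I * ((-r * k ^ 2 : ℝ) : ℂ)) * ft g k) (-x) := by
  rw [Tevol, ft]
  congr 2
  ext k
  rw [mul_assoc]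
  congr 2 <;> push_cast <;> ring_nf

theorem exists_norm_schwartz_le (φ : 𝓢(ℝ, ℂ)) :
    ∃ A : ℝ, 0 < A ∧ ∀ x, ‖φ x‖ ≤ A * ((1 + |x|) ^ 2)⁻¹ := by
  refine ⟨2 ^ 2 * (Finset.Iic (2, 0)).sup
    (fun m : ℕ × ℕ ↦ SchwartzMap.seminorm ℝ m.1 m.2) φ + 1, by positivity, fun x ↦ ?_⟩
  have h := SchwartzMap.one_add_le_sup_seminorm_apply (𝕜 := ℝ) (m := (2, 0)) le_rfl le_rfl φ x
  rw [norm_iteratedFDeriv_zero, Real.norm_eq_abs] at h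
  rw [le_mul_inv_iff₀ (by positivity), mul_comm]
  exact h.trans (by dsimp only; linarith)

theorem integrable_cubic {p : ℝ → ℂ} (hp : Integrable p) (hp' : Integrable (ft p)) :
    Integrable fun x ↦ ft p (-x) * (starRingEnd ℂ) (ft p (-x)) * ft p (-x) := by
  have hc : Continuous fun x ↦ ft p (-x) := (continuous_ft hp).comp continuous_neg
  set B := (√(2 * Real.pi))⁻¹ * ∫ x, ‖p x‖ with hB
  have hB0 : 0 ≤ B := by positivity
  refine hp'.comp_neg.bdd_mul (c := B * B) ?_ (Eventually.of_forall fun x ↦ ?_)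
  · exact (hc.mul (Complex.continuous_conj.comp hc)).aestronglyMeasurable
  · rw [norm_mul, RCLike.norm_conj]
    have := norm_ft_le p (-x)
    gcongr

/-- The cubic nonlinearity evaluated along the free evolution. -/
noncomputable def evolCubic (f : ℝ → ℂ) (v x : ℝ) : ℂ :=
  Tevol v f x * (starRingEnd ℂ) (Tevol v f x) * Tevol v f x

/-- The profile of the cubic nonlinearity along the free evolution on the Fourier side. -/
noncomputable def phaseInt (φ : ℝ → ℂ) (v k : ℝ) : ℂ :=
  ((2 * Real.pi : ℝ) : ℂ)⁻¹ *
    ∫ z, tri φ k z * Complex.exp (((2 * v * (z.1 * z.2) : ℝ) : ℂ) * Complex.I)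

theorem exists_norm_phaseInt_le {φ : ℝ → ℂ} {A : ℝ} (hφ : Continuous φ) (hA : 0 ≤ A)
    (h : ∀ x, ‖φ x‖ ≤ A * ((1 + |x|) ^ 2)⁻¹) :
    ∃ B, 0 ≤ B ∧ ∀ v k, ‖phaseInt φ v k‖ ≤ B * ((1 + |k|) ^ 2)⁻¹ := by
  obtain ⟨C, hC, H⟩ := exists_integral_norm_tri_le
  have hpi := Real.two_pi_pos
  refine ⟨(2 * Real.pi)⁻¹ * (C * A ^ 3), by positivity, fun v k ↦ ?_⟩
  rw [phaseInt, norm_mul, norm_inv, Complex.norm_real, Real.norm_eq_abs, abs_of_pos hpi, mul_assoc]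
  gcongr
  refine (norm_integral_le_integral_norm _).trans ?_
  simp_rw [norm_mul, Complex.norm_exp_ofReal_mul_I, mul_one]
  exact (H φ A hφ hA h k).2

theorem measurable_phaseInt {φ : ℝ → ℂ} (hφ : Continuous φ) :
    Measurable (Function.uncurry (phaseInt φ)) := by
  have h : Continuous (Function.uncurry fun (q : ℝ × ℝ) (z : ℝ × ℝ) ↦
      tri φ q.2 z * Complex.exp (((2 * q.1 * (z.1 * z.2) : ℝ) : ℂ) * Complex.I)) := by
    refine Continuous.mul ?_ (by fun_prop)
    exact (continuous_tri hφ).comp (f := fun q : (ℝ × ℝ) × ℝ × ℝ ↦ (q.1.2, q.2)) (by fun_prop)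
  exact (h.stronglyMeasurable.integral_prod_right (ν := volume)).measurable.const_mul _

theorem integrable_inv_one_add_abs_sq : Integrable fun x : ℝ ↦ ((1 + |x|) ^ 2)⁻¹ := by
  have := integrable_one_add_norm (E := ℝ) (μ := volume) (r := 2) (by simp)
  refine this.congr (Eventually.of_forall fun x ↦ ?_)
  simp only [Real.norm_eq_abs]
  rw [Real.rpow_neg (by positivity)]
  norm_num

section Schwartz

variable (f : 𝓢(ℝ, ℂ))

theorem exists_evolCubic_eq (v : ℝ) : ∃ p : 𝓢(ℝ, ℂ),
    (⇑p = fun k ↦ Complex.exp (Complex.I * ((-v * k ^ 2 : ℝ) : ℂ)) * ft f k) ∧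
    evolCubic f v = fun x ↦ ft p (-x) * (starRingEnd ℂ) (ft p (-x)) * ft p (-x) := by
  obtain ⟨φ, hφ⟩ := exists_schwartz_eq_ft f
  obtain ⟨p, hp⟩ := exists_schwartz_eq_chirp_mul (-v) φ
  refine ⟨p, by rw [hp, hφ], ?_⟩
  ext x
  rw [evolCubic, tevol_eq_ft, hp, hφ]

theorem integrable_evolCubic (v : ℝ) : Integrable (evolCubic f v) := by
  obtain ⟨p, -, hp⟩ := exists_evolCubic_eq f v
  rw [hp]
  exact integrable_cubic p.integrable (integrable_ft_schwartz p)

theorem ft_evolCubic (v k : ℝ) : ft (evolCubic f v) k =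
    Complex.exp (Complex.I * ((-v * k ^ 2 : ℝ) : ℂ)) * phaseInt (ft f) v k := by
  obtain ⟨p, hp, hp'⟩ := exists_evolCubic_eq f v
  obtain ⟨A, hA, hpA⟩ := exists_norm_schwartz_le p
  obtain ⟨C, hC, H⟩ := exists_integral_norm_tri_le
  rw [hp', ft_cubic p.continuous p.integrable (integrable_ft_schwartz p)
    (H p A p.continuous hA.le hpA k).1, hp]
  simp_rw [tri_chirp_mul]
  rw [integral_const_mul, phaseInt, mul_left_comm]
  congr 4
  ext z
  congr 3
  push_cast
  ring

theorem phaseInt_eq (v k : ℝ) : phaseInt (ft f) v k =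
    Complex.exp (Complex.I * ((v * k ^ 2 : ℝ) : ℂ)) * ft (evolCubic f v) k := by
  rw [ft_evolCubic, ← mul_assoc, ← Complex.exp_add, ← mul_add, ← Complex.ofReal_add]
  simp

theorem tevol_neg_evolCubic (v x : ℝ) :
    Tevol (-v) (evolCubic f v) x = ft (phaseInt (ft f) v) (-x) := by
  rw [tevol_eq_ft]
  congr 1
  ext k
  rw [neg_neg, phaseInt_eq]

theorem continuous_phaseInt (v : ℝ) : Continuous (phaseInt (ft f) v) := by
  have : phaseInt (ft f) v = _ := funext (phaseInt_eq f v)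
  rw [this]
  have := continuous_ft (integrable_evolCubic f v)
  fun_prop

theorem exists_norm_phaseInt_ft_le :
    ∃ B, 0 ≤ B ∧ ∀ v k, ‖phaseInt (ft f) v k‖ ≤ B * ((1 + |k|) ^ 2)⁻¹ := by
  obtain ⟨φ, hφ⟩ := exists_schwartz_eq_ft f
  obtain ⟨A, hA, hφA⟩ := exists_norm_schwartz_le φ
  rw [← hφ]
  exact exists_norm_phaseInt_le φ.continuous hA.le hφA

theorem integrable_phaseInt (v : ℝ) : Integrable (phaseInt (ft f) v) := by
  obtain ⟨B, -, h⟩ := exists_norm_phaseInt_ft_le f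
  exact (integrable_inv_one_add_abs_sq.const_mul B).mono'
    (continuous_phaseInt f v).aestronglyMeasurable (Eventually.of_forall (h v))

/-- On the Fourier side the dispersion management equation becomes an algebraic one. -/
theorem mul_ft_eq_of_eq {L : ℝ} (hL : 0 ≤ L) {E : ℝ → ℝ} (hE : Continuous E) {ω d c : ℂ}
    (heq : ∀ x, ω * f x = d * deriv (deriv f) x +
      c * ∫ s in (0:ℝ)..L, Tevol (-(E s)) (evolCubic f (E s)) x) (k : ℝ) :
    (ω + d * ((k ^ 2 : ℝ) : ℂ)) * ft f k = c * ∫ s in (0:ℝ)..L, phaseInt (ft f) (E s) k := by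
  obtain ⟨B, hB0, hB⟩ := exists_norm_phaseInt_ft_le f
  obtain ⟨φ, hφ⟩ := exists_schwartz_eq_ft f
  have hmeas : Measurable fun q : ℝ × ℝ ↦ phaseInt (ft f) (E q.1) q.2 := by
    have := measurable_phaseInt (φ := ft f) (hφ ▸ φ.continuous)
    exact this.comp ((hE.measurable.comp measurable_fst).prodMk measurable_snd)
  have h_int : Integrable (fun q : ℝ × ℝ ↦ phaseInt (ft f) (E q.1) q.2)
      ((volume.restrict (Ioc 0 L)).prod volume) := by
    have h1 : Integrable (fun q : ℝ × ℝ ↦ B * ((1 + |q.2|) ^ 2)⁻¹)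
        ((volume.restrict (Ioc 0 L)).prod volume) :=
      (integrable_inv_one_add_abs_sq.const_mul B).comp_snd _
    exact h1.mono' hmeas.aestronglyMeasurable (Eventually.of_forall fun q ↦ hB _ _)
  set Q : ℝ → ℂ := fun k ↦ c * ∫ s in (0:ℝ)..L, phaseInt (ft f) (E s) k with hQ
  have hQc : Continuous Q := by
    refine continuous_const.mul ?_
    simp_rw [intervalIntegral.integral_of_le hL]
    refine continuous_of_dominated (bound := fun _ ↦ B) (fun k ↦ ?_)
      (fun k ↦ Eventually.of_forall fun s ↦ (hB _ _).trans ?_) (integrable_const _)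
      (Eventually.of_forall fun s ↦ continuous_phaseInt f _)
    · exact (hmeas.comp (measurable_id.prodMk measurable_const)).aestronglyMeasurable
    · refine mul_le_of_le_one_right hB0 (inv_le_one_of_one_le₀ ?_)
      exact one_le_pow₀ (by linarith [abs_nonneg k])
  have hQi : Integrable Q := by
    have := h_int.integral_prod_right.const_mul c
    simpa only [hQ, intervalIntegral.integral_of_le hL] using this
  have hftQ : ∀ y, ft Q y = c * ∫ s in (0:ℝ)..L, ft (phaseInt (ft f) (E s)) y := by
    intro y
    have h_int' : Integrable (Function.uncurry fun s k : ℝ ↦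
        Complex.exp (Complex.I * y * k) * phaseInt (ft f) (E s) k)
        ((volume.restrict (Ioc 0 L)).prod volume) := by
      refine h_int.bdd_mul (c := 1) (Continuous.aestronglyMeasurable (by fun_prop))
        (Eventually.of_forall fun q ↦ ?_)
      rw [norm_cexp_I_mul_mul]
    simp only [ft, hQ, intervalIntegral.integral_of_le hL]
    rw [integral_const_mul, integral_integral_swap h_int', mul_left_comm]
    congr 1
    rw [← integral_const_mul]
    congr 1
    ext k
    rw [integral_const_mul, mul_left_comm]
  set G : ℝ → ℂ := fun x ↦ ω * f x - d * deriv (deriv f) x with hG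
  have hGs : ∃ ψ : 𝓢(ℝ, ℂ), ⇑ψ = G := by
    refine ⟨ω • f - d • SchwartzMap.derivCLM ℂ ℂ (SchwartzMap.derivCLM ℂ ℂ f), ?_⟩
    have h1 : (SchwartzMap.derivCLM ℂ ℂ f : ℝ → ℂ) = deriv f := by
      ext x
      simp
    ext x
    simp [hG, h1]
  obtain ⟨ψ, hψ⟩ := hGs
  have hGQ : G = fun x ↦ ft Q (-x) := by
    ext x
    rw [hftQ, hG]
    simp_rw [← tevol_neg_evolCubic]
    rw [heq]
    ring
  have hQ' : Integrable (ft Q) := by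
    have : Integrable fun x ↦ ft Q (-x) := hGQ ▸ hψ ▸ ψ.integrable
    simpa using this.comp_neg
  have h1 : ft G k = Q k := by rw [hGQ, ft_ft_comp_neg hQc hQi hQ']
  have hfi : Integrable fun x ↦ ω * f x := f.integrable.const_mul ω
  have hdi : Integrable fun x ↦ d * deriv (deriv f) x := by
    refine (hfi.sub ψ.integrable).congr (Eventually.of_forall fun x ↦ ?_)
    simp [hψ, hG]
  refine Eq.trans ?_ h1
  rw [hG, ft, ft]
  simp_rw [mul_sub]
  rw [integral_sub, mul_sub]
  · simp_rw [mul_left_comm _ ω, mul_left_comm _ d]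
    rw [integral_const_mul, integral_const_mul, mul_left_comm _ ω, mul_left_comm _ d, ← ft, ← ft,
      ft_deriv_deriv]
    ring
  · exact hfi.bdd_mul (c := 1) (Continuous.aestronglyMeasurable (by fun_prop))
      (Eventually.of_forall fun x ↦ (norm_cexp_I_mul_mul _ _).le)
  · exact hdi.bdd_mul (c := 1) (Continuous.aestronglyMeasurable (by fun_prop))
      (Eventually.of_forall fun x ↦ (norm_cexp_I_mul_mul _ _).le)

end Schwartz

theorem le_of_ofReal_le_triConv {g : ℝ → ℝ} {M C W N y : ℝ} {k : ℝ} (hM : 0 ≤ M)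
    (hC : 0 ≤ C) (hN : 0 ≤ N) (hW : 0 ≤ W)
    (h : ENNReal.ofReal y ≤ ENNReal.ofReal M * triConv g k)
    (hg : triConv g k ≤ ENNReal.ofReal (C * N ^ 3 * W)) : y ≤ M * C * N ^ 3 * W := by
  have h1 : ENNReal.ofReal y ≤ ENNReal.ofReal M * ENNReal.ofReal (C * N ^ 3 * W) :=
    h.trans (by gcongr)
  rw [← ENNReal.ofReal_mul hM, ENNReal.ofReal_le_ofReal_iff (by positivity)] at h1
  linarith

theorem exp_decay_of_ofReal_le_triConv {g : ℝ → ℝ} {A M : ℝ} (hg : ∀ x, 0 ≤ g x) (hA : 0 < A)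
    (hM : 0 < M) (h0 : ∀ x, g x ≤ A * ((1 + |x|) ^ 2)⁻¹)
    (h : ∀ k, ENNReal.ofReal (g k) ≤ ENNReal.ofReal M * triConv g k) :
    ∃ K > 0, ∃ μ > 0, ∀ x, g x ≤ K * Real.exp (-μ * |x|) := by
  obtain ⟨C, hC, H⟩ := exists_triConv_le
  refine exp_decay_of_bootstrap (C := M * C) hA one_pos (by positivity) h0
    fun μ hμ _ n N hn hN hgN x ↦ ?_
  have := decayWeight_pos μ n x
  exact le_of_ofReal_le_triConv hM.le hC.le hN (by positivity) (h x)
    (H g μ n N hg hμ hn hN hgN x)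

theorem inv_sqrt_abs_mul {c a b : ℝ} (hc : 0 < c) :
    (√|c * (a * b)|)⁻¹ = (√c)⁻¹ * ((√|a|)⁻¹ * (√|b|)⁻¹) := by
  rw [abs_mul, abs_mul, abs_of_pos hc, Real.sqrt_mul hc.le, Real.sqrt_mul (abs_nonneg a), mul_inv,
    mul_inv]

theorem exp_decay_ft_of_eq {L : ℝ} (hL : 0 < L) {E : ℝ → ℝ} (hE : Continuous E) {U K : ℝ}
    (hU : ∀ s, |E s| ≤ U) (hK0 : 0 ≤ K)
    (hK : ∀ Θ : ℝ → ℂ, Continuous Θ → ∀ M, (∀ s, ‖∫ v in (0:ℝ)..E s, Θ v‖ ≤ M) →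
      ‖∫ s in (0:ℝ)..L, Θ (E s)‖ ≤ K * M)
    {ω d : ℝ} (hω : 0 < ω) (hd : 0 ≤ d) (f : 𝓢(ℝ, ℂ))
    (heq : ∀ x, (ω : ℂ) * f x = (d : ℂ) * deriv (deriv f) x +
      ((1 / L : ℝ) : ℂ) * ∫ s in (0:ℝ)..L, Tevol (-(E s)) (evolCubic f (E s)) x) :
    ∃ K > 0, ∃ μ > 0, ∀ k, ‖ft f k‖ ≤ K * Real.exp (-μ * |k|) := by
  obtain ⟨φ, hφ⟩ := exists_schwartz_eq_ft f
  obtain ⟨A, hA, hφA⟩ := exists_norm_schwartz_le φ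
  obtain ⟨C, hC, H⟩ := exists_integral_norm_tri_le
  have hU0 : 0 ≤ U := (abs_nonneg _).trans (hU 0)
  set M := (K + 1) * (2 + U) with hM
  have hM0 : 0 < M := by positivity
  have hpi := Real.two_pi_pos
  rw [hφ] at hφA
  refine exp_decay_of_ofReal_le_triConv (g := fun k ↦ ‖ft f k‖) (fun _ ↦ norm_nonneg _) hA
    (M := ω⁻¹ * (1 / L) * (2 * Real.pi)⁻¹ * M) (by positivity) hφA fun k ↦ ?_
  have h1 := mul_ft_eq_of_eq f hL.le hE heq k
  have hosc := ofReal_norm_integral_tri_le (φ := ft f) (k := k)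
    (H _ A (hφ ▸ φ.continuous) hA.le hφA k).1
    (θ := fun v z ↦ Complex.exp (((2 * v * (z.1 * z.2) : ℝ) : ℂ) * Complex.I))
    (Continuous.measurable (by fun_prop)) (B := 1)
    (fun v z ↦ (Complex.norm_exp_ofReal_mul_I _).le) hE hL.le hM0.le ?_
  · simp_rw [phaseInt] at h1
    rw [intervalIntegral.integral_const_mul] at h1
    set J := ∫ s in (0:ℝ)..L, ∫ z, tri (ft f) k z *
      Complex.exp (((2 * E s * (z.1 * z.2) : ℝ) : ℂ) * Complex.I) with hJ
    have h2 : ω * ‖ft f k‖ ≤ (1 / L) * (2 * Real.pi)⁻¹ * ‖J‖ := by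
      have h3 := congrArg norm h1
      rw [← Complex.ofReal_mul, ← Complex.ofReal_add, norm_mul, norm_mul, norm_mul, norm_inv,
        Complex.norm_real, Complex.norm_real, Complex.norm_real, Real.norm_eq_abs,
        Real.norm_eq_abs, Real.norm_eq_abs, abs_of_pos hpi, abs_of_pos (one_div_pos.2 hL),
        abs_of_nonneg (by positivity), ← mul_assoc] at h3
      rw [← h3]
      gcongr
      nlinarith [mul_nonneg hd (sq_nonneg k)]
    have h4 : ‖ft f k‖ ≤ ω⁻¹ * (1 / L) * (2 * Real.pi)⁻¹ * ‖J‖ := by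
      rw [mul_assoc, mul_assoc, ← mul_assoc (1 / L), le_inv_mul_iff₀ hω]
      exact h2
    calc _ ≤ ENNReal.ofReal (ω⁻¹ * (1 / L) * (2 * Real.pi)⁻¹ * ‖J‖) := ENNReal.ofReal_le_ofReal h4
      _ = ENNReal.ofReal (ω⁻¹ * (1 / L) * (2 * Real.pi)⁻¹) * ENNReal.ofReal ‖J‖ :=
        ENNReal.ofReal_mul (by positivity)
      _ ≤ ENNReal.ofReal (ω⁻¹ * (1 / L) * (2 * Real.pi)⁻¹) *
          (ENNReal.ofReal M * triConv (fun k ↦ ‖ft f k‖) k) := by gcongr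
      _ = _ := by rw [← mul_assoc, ← ENNReal.ofReal_mul (by positivity)]
  · intro z hz1 hz2
    have hτ : 2 * (z.1 * z.2) ≠ 0 := by positivity
    have := hK (fun v ↦ Complex.exp (Complex.I * ((2 * (z.1 * z.2) : ℝ) : ℂ) * v)) (by fun_prop)
      _ (fun s ↦ norm_integral_cexp_le (hU s) hτ)
    have hrw : ∀ s : ℝ, Complex.exp (((2 * E s * (z.1 * z.2) : ℝ) : ℂ) * Complex.I) =
        Complex.exp (Complex.I * ((2 * (z.1 * z.2) : ℝ) : ℂ) * E s) := by
      intro s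
      congr 1
      push_cast
      ring
    simp_rw [hrw]
    refine this.trans ?_
    rw [div_eq_mul_inv, inv_sqrt_abs_mul two_pos, hM, ← mul_assoc, ← mul_assoc]
    have h2 : (√2)⁻¹ ≤ 1 := inv_le_one_of_one_le₀ (by
      rw [Real.one_le_sqrt]
      norm_num)
    have h3 : 0 ≤ (√|z.1|)⁻¹ * (√|z.2|)⁻¹ := by positivity
    have h4 : K * (2 + U) * (√2)⁻¹ ≤ (K + 1) * (2 + U) := by
      calc _ ≤ K * (2 + U) * 1 := by gcongr
        _ ≤ _ := by nlinarith
    gcongr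

/-- The constant in the integral kernel of the free Schrödinger evolution. -/
noncomputable def fresnelConst (r : ℝ) : ℂ :=
  ((√(2 * Real.pi) : ℝ) : ℂ)⁻¹ * (Real.pi / (Complex.I * r)) ^ (1 / 2 : ℂ)

theorem norm_cexp_neg_mul_sq_le_one {b : ℂ} (hb : 0 ≤ b.re) (t : ℝ) :
    ‖Complex.exp (-b * (t : ℂ) ^ 2)‖ ≤ 1 := by
  rw [Complex.norm_exp, Real.exp_le_one_iff, ← Complex.ofReal_pow, Complex.re_mul_ofReal,
    Complex.neg_re]
  nlinarith [mul_nonneg hb (sq_nonneg t)]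

theorem integral_gaussian_mul_ft {φ : ℝ → ℂ} (hφ : Integrable φ) {b : ℂ} (hb : 0 < b.re) (x : ℝ) :
    ((√(2 * Real.pi) : ℝ) : ℂ)⁻¹ * ∫ k : ℝ, Complex.exp (-(Complex.I * x * k)) *
      Complex.exp (-b * k ^ 2) * ft φ k =
    ((2 * Real.pi : ℝ) : ℂ)⁻¹ * (Real.pi / b) ^ (1 / 2 : ℂ) *
      ∫ y : ℝ, Complex.exp (-(4 * b)⁻¹ * ((y - x : ℝ) : ℂ) ^ 2) * φ y := by
  have h_int : Integrable (Function.uncurry fun k y : ℝ ↦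
      Complex.exp (Complex.I * ((y - x : ℝ) : ℂ) * k) * (Complex.exp (-b * k ^ 2) * φ y))
      (volume.prod volume) := by
    have h1 := (integrable_cexp_neg_mul_sq hb).mul_prod hφ
    refine h1.bdd_mul (c := 1) (Continuous.aestronglyMeasurable (by fun_prop))
      (Eventually.of_forall fun q ↦ (norm_cexp_I_mul_mul _ _).le)
  have h2 : ∀ k : ℝ, Complex.exp (-(Complex.I * x * k)) * Complex.exp (-b * k ^ 2) * ft φ k =
      ((√(2 * Real.pi) : ℝ) : ℂ)⁻¹ * ∫ y : ℝ,
        Complex.exp (Complex.I * ((y - x : ℝ) : ℂ) * k) * (Complex.exp (-b * k ^ 2) * φ y) := by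
    intro k
    rw [ft, mul_left_comm, ← integral_const_mul]
    congr 2
    ext y
    rw [show Complex.I * ((y - x : ℝ) : ℂ) * k = -(Complex.I * x * k) + Complex.I * k * y by
      push_cast; ring, Complex.exp_add]
    ring
  simp_rw [h2]
  rw [integral_const_mul, integral_integral_swap h_int, ← mul_assoc, ← mul_inv,
    ← Complex.ofReal_mul, Real.mul_self_sqrt Real.two_pi_pos.le, mul_assoc _ (_ ^ _),
    ← integral_const_mul ((Real.pi / b) ^ (1 / 2 : ℂ))]
  congr 2
  ext y
  simp_rw [← mul_assoc]
  rw [integral_mul_const, fourierIntegral_gaussian hb]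
  congr 3
  rw [neg_div, neg_mul, div_eq_inv_mul]

theorem tevol_eq_fresnel {φ : ℝ → ℂ} (hφ : Integrable φ) (hφ' : Integrable (ft φ)) {r : ℝ}
    (hr : r ≠ 0) (x : ℝ) :
    Tevol r φ x = fresnelConst r * (Complex.exp (Complex.I * (((4 * r)⁻¹ * x ^ 2 : ℝ) : ℂ)) *
      ft (fun y ↦ Complex.exp (Complex.I * (((4 * r)⁻¹ * y ^ 2 : ℝ) : ℂ)) * φ y)
        (-(x / (2 * r)))) := by
  set b : ℝ → ℂ := fun ε ↦ ε + Complex.I * r with hb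
  have hbre : ∀ ε, (b ε).re = ε := fun ε ↦ by simp [hb]
  have hb0 : ∀ ε, b ε ≠ 0 := fun ε h ↦ hr (by simpa [hb] using congrArg Complex.im h)
  have hbc : Continuous b := by fun_prop
  have hr' : (r : ℂ) ≠ 0 := by exact_mod_cast hr
  have hl1 : Tendsto (fun ε ↦ ((√(2 * Real.pi) : ℝ) : ℂ)⁻¹ * ∫ k : ℝ,
      Complex.exp (-(Complex.I * x * k)) * Complex.exp (-b ε * k ^ 2) * ft φ k)
      (𝓝[>] 0) (𝓝 (Tevol r φ x)) := by
    refine Tendsto.const_mul _ ?_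
    refine tendsto_integral_filter_of_dominated_convergence (fun k ↦ ‖ft φ k‖) ?_ ?_ hφ'.norm ?_
    · refine Eventually.of_forall fun ε ↦ ?_
      exact (Continuous.aestronglyMeasurable (by fun_prop)).mul hφ'.1
    · filter_upwards [self_mem_nhdsWithin] with ε hε
      refine Eventually.of_forall fun k ↦ ?_
      rw [norm_mul, norm_mul]
      have h1 : ‖Complex.exp (-(Complex.I * x * k))‖ = 1 := by
        rw [Complex.exp_neg, norm_inv, norm_cexp_I_mul_mul, inv_one]
      have h2 := norm_cexp_neg_mul_sq_le_one (b := b ε) (by rw [hbre]; exact (mem_Ioi.1 hε).le) k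
      rw [h1, one_mul]
      exact mul_le_of_le_one_left (norm_nonneg _) h2
    · refine Eventually.of_forall fun k ↦ ?_
      have hcont : Continuous fun ε ↦
          Complex.exp (-(Complex.I * x * k)) * Complex.exp (-b ε * k ^ 2) * ft φ k := by fun_prop
      have := (hcont.tendsto 0).mono_left (nhdsWithin_le_nhds (s := Ioi 0))
      simpa [hb] using this
  have hl2 : Tendsto (fun ε ↦ ((2 * Real.pi : ℝ) : ℂ)⁻¹ * (Real.pi / b ε) ^ (1 / 2 : ℂ) *
      ∫ y : ℝ, Complex.exp (-(4 * b ε)⁻¹ * ((y - x : ℝ) : ℂ) ^ 2) * φ y) (𝓝[>] 0)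
      (𝓝 (((2 * Real.pi : ℝ) : ℂ)⁻¹ * (Real.pi / b 0) ^ (1 / 2 : ℂ) *
        ∫ y : ℝ, Complex.exp (-(4 * b 0)⁻¹ * ((y - x : ℝ) : ℂ) ^ 2) * φ y)) := by
    refine Tendsto.mul (Tendsto.const_mul _ ?_) ?_
    · have h1 : Tendsto (fun ε ↦ (Real.pi : ℂ) / b ε) (𝓝[>] 0) (𝓝 (Real.pi / b 0)) :=
        ((continuous_const.div hbc hb0).tendsto 0).mono_left nhdsWithin_le_nhds
      refine h1.cpow tendsto_const_nhds (Or.inr ?_)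
      simp [hb, Complex.div_im, hr, Real.pi_ne_zero]
    · refine tendsto_integral_filter_of_dominated_convergence (fun y ↦ ‖φ y‖) ?_ ?_ hφ.norm ?_
      · refine Eventually.of_forall fun ε ↦ ?_
        exact (Continuous.aestronglyMeasurable (by fun_prop)).mul hφ.1
      · filter_upwards [self_mem_nhdsWithin] with ε hε
        refine Eventually.of_forall fun y ↦ ?_
        rw [norm_mul]
        refine mul_le_of_le_one_left (norm_nonneg _) (norm_cexp_neg_mul_sq_le_one ?_ _)
        rw [Complex.inv_re]
        refine div_nonneg ?_ (Complex.normSq_nonneg _)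
        have : (4 * b ε).re = 4 * ε := by simp [hb]
        rw [this]
        have := mem_Ioi.1 hε
        positivity
      · refine Eventually.of_forall fun y ↦ ?_
        have h4 : Continuous fun ε ↦ (4 * b ε)⁻¹ :=
          (continuous_const.mul hbc).inv₀ fun ε ↦ mul_ne_zero (by norm_num) (hb0 ε)
        have hcont : Continuous fun ε ↦
          Complex.exp (-(4 * b ε)⁻¹ * ((y - x : ℝ) : ℂ) ^ 2) * φ y := by fun_prop
        exact (hcont.tendsto 0).mono_left nhdsWithin_le_nhds
  have hl := tendsto_nhds_unique (hl2.congr' ?_) hl1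
  · rw [← hl]
    have hb00 : b 0 = Complex.I * r := by simp [hb]
    rw [hb00, fresnelConst, ft, mul_left_comm _ (_⁻¹), ← integral_const_mul]
    rw [show ((2 * Real.pi : ℝ) : ℂ)⁻¹ = ((√(2 * Real.pi) : ℝ) : ℂ)⁻¹ *
      ((√(2 * Real.pi) : ℝ) : ℂ)⁻¹ by
        rw [← mul_inv, ← Complex.ofReal_mul, Real.mul_self_sqrt Real.two_pi_pos.le]]
    have : ∀ y : ℝ, Complex.exp (-(4 * (Complex.I * r))⁻¹ * ((y - x : ℝ) : ℂ) ^ 2) * φ y =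
        Complex.exp (Complex.I * (((4 * r)⁻¹ * x ^ 2 : ℝ) : ℂ)) *
        (Complex.exp (Complex.I * ((-(x / (2 * r)) : ℝ) : ℂ) * y) *
          (Complex.exp (Complex.I * (((4 * r)⁻¹ * y ^ 2 : ℝ) : ℂ)) * φ y)) := by
      intro y
      simp only [← mul_assoc (Complex.exp _), ← Complex.exp_add]
      congr 2
      push_cast
      rw [mul_inv 4, mul_inv Complex.I, Complex.inv_I]
      field_simp
      ring
    simp_rw [this]
    rw [integral_const_mul, integral_const_mul]
    ring
  · filter_upwards [self_mem_nhdsWithin] with ε hε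
    exact (integral_gaussian_mul_ft hφ (by rw [hbre]; exact hε) x).symm

theorem norm_fresnelConst_sq (r : ℝ) : ‖fresnelConst r‖ ^ 2 = |2 * r|⁻¹ := by
  have hpi := Real.two_pi_pos
  rw [fresnelConst, norm_mul, mul_pow, ← norm_pow (_ ^ _)]
  have : (1 / 2 : ℂ) = ((2 : ℕ) : ℂ)⁻¹ := by norm_num
  rw [this, Complex.cpow_nat_inv_pow _ two_ne_zero, norm_inv, Complex.norm_real, Real.norm_eq_abs,
    abs_of_nonneg (Real.sqrt_nonneg _), inv_pow, Real.sq_sqrt hpi.le, norm_div, norm_mul]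
  simp only [Complex.norm_real, Complex.norm_I, one_mul, Real.norm_eq_abs, abs_mul]
  rw [abs_of_pos Real.pi_pos, abs_of_pos (two_pos (α := ℝ))]
  have := Real.pi_pos
  field_simp

theorem fresnelConst_neg {r : ℝ} (hr : r ≠ 0) :
    fresnelConst (-r) = (starRingEnd ℂ) (fresnelConst r) := by
  have harg : (Real.pi / (Complex.I * r) : ℂ).arg ≠ Real.pi := by
    intro h
    have := Complex.arg_eq_pi_iff.1 h
    simp [Complex.div_im, hr, Real.pi_ne_zero] at this
  have h := Complex.conj_cpow _ (1 / 2) harg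
  have h2 : (starRingEnd ℂ) (1 / 2) = 1 / 2 := by
    rw [Complex.conj_eq_iff_im]
    norm_num
  rw [h2] at h
  rw [fresnelConst, fresnelConst, map_mul, map_inv₀, Complex.conj_ofReal, ← h]
  simp

theorem fresnelConst_neg_mul {r : ℝ} (hr : r ≠ 0) :
    fresnelConst (-r) * fresnelConst r = ((|2 * r|⁻¹ : ℝ) : ℂ) := by
  rw [fresnelConst_neg hr, Complex.conj_mul', ← norm_fresnelConst_sq]
  push_cast
  rfl

theorem norm_fresnelCutoff_le {η : ℝ} (hη : 0 < η) (τ v : ℝ) : ‖fresnelCutoff η τ v‖ ≤ η⁻¹ := by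
  rcases le_or_gt |v| η with h | h
  · rw [fresnelCutoff_eq_zero h, norm_zero]
    positivity
  · rw [norm_fresnelCutoff, max_eq_right (by linarith), ← sq_abs v]
    have hv : 0 < |v| := hη.trans h
    calc (|v| - η) / |v| ^ 2 ≤ |v| / |v| ^ 2 := by gcongr; linarith
      _ = |v|⁻¹ := by field_simp
      _ ≤ η⁻¹ := by gcongr

theorem measurable_fresnelCutoff_mul (η c : ℝ) :
    Measurable (Function.uncurry fun (v : ℝ) (z : ℝ × ℝ) ↦ fresnelCutoff η (c * (z.1 * z.2)) v) := by
  unfold fresnelCutoff Function.uncurry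
  fun_prop

theorem ft_comp_div {W : ℝ → ℂ} {c : ℝ} (hc : c ≠ 0) (x : ℝ) :
    ft (fun y ↦ W (y / c)) (x / c) = ((|c| : ℝ) : ℂ) * ft W x := by
  have h := Measure.integral_comp_div (fun t : ℝ ↦ Complex.exp (Complex.I * x * t) * W t) c
  rw [ft, ft, mul_left_comm, ← Complex.real_smul, ← h]
  congr 2
  ext y
  congr 2
  push_cast
  have : (c : ℂ) ≠ 0 := by exact_mod_cast hc
  field_simp

theorem ft_const_mul (c : ℂ) (g : ℝ → ℂ) (k : ℝ) : ft (fun x ↦ c * g x) k = c * ft g k := by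
  simp_rw [ft, mul_left_comm _ c]
  rw [integral_const_mul, mul_left_comm]

theorem conj_cexp_I_mul (t : ℝ) :
    (starRingEnd ℂ) (Complex.exp (Complex.I * (t : ℂ))) * Complex.exp (Complex.I * (t : ℂ)) = 1 := by
  rw [← Complex.exp_conj, ← Complex.exp_add]
  simp

section Schwartz

variable (f : 𝓢(ℝ, ℂ))

theorem integrable_ft_evolCubic (v : ℝ) : Integrable (ft (evolCubic f v)) := by
  have : ft (evolCubic f v) = _ := funext (ft_evolCubic f v)
  rw [this]
  refine (integrable_phaseInt f v).bdd_mul (c := 1)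
    (Continuous.aestronglyMeasurable (by fun_prop)) (Eventually.of_forall fun k ↦ ?_)
  rw [mul_comm, Complex.norm_exp_ofReal_mul_I]

/-- The profile of the nonlinearity in position space. -/
theorem tevol_neg_evolCubic_eq {v : ℝ} (hv : v ≠ 0) (x : ℝ) :
    Tevol (-v) (evolCubic f v) x = (((4 * Real.pi * |v|)⁻¹ : ℝ) : ℂ) *
      ∫ z, tri f x z * Complex.exp (((-(1 / 2 * (z.1 * z.2) / v) : ℝ) : ℂ) * Complex.I) := by
  set α : ℝ := (4 * v)⁻¹ with hα
  have h2v : 2 * v ≠ 0 := mul_ne_zero two_ne_zero hv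
  obtain ⟨p, hp⟩ := exists_schwartz_eq_chirp_mul α f
  set c := fresnelConst v with hc
  set W : ℝ → ℂ := fun t ↦ ft p (-t) * (starRingEnd ℂ) (ft p (-t)) * ft p (-t) with hW
  have hT : ∀ y, Tevol v f y =
      c * (Complex.exp (Complex.I * ((α * y ^ 2 : ℝ) : ℂ)) * ft p (-(y / (2 * v)))) := by
    intro y
    rw [tevol_eq_fresnel f.integrable (integrable_ft_schwartz f) hv, hp]
  have hcc : c * (starRingEnd ℂ) c = ((|2 * v|⁻¹ : ℝ) : ℂ) := by
    rw [hc, ← fresnelConst_neg hv, mul_comm, fresnelConst_neg_mul hv]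
  have hcubic : ∀ y, Complex.exp (Complex.I * ((-α * y ^ 2 : ℝ) : ℂ)) * evolCubic f v y =
      c * ((|2 * v|⁻¹ : ℝ) : ℂ) * W (y / (2 * v)) := by
    intro y
    have he := conj_cexp_I_mul (α * y ^ 2)
    have he' : Complex.exp (Complex.I * ((-α * y ^ 2 : ℝ) : ℂ)) *
        Complex.exp (Complex.I * ((α * y ^ 2 : ℝ) : ℂ)) = 1 := by
      rw [← Complex.exp_add]
      simp
    rw [evolCubic, hT, ← hcc, hW]
    simp only [map_mul]
    set e := Complex.exp (Complex.I * ((α * y ^ 2 : ℝ) : ℂ))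
    set e' := Complex.exp (Complex.I * ((-α * y ^ 2 : ℝ) : ℂ))
    set q := ft p (-(y / (2 * v)))
    calc _ = (e' * e) * ((starRingEnd ℂ) e * e) *
          (c * (c * (starRingEnd ℂ) c) * (q * (starRingEnd ℂ) q * q)) := by ring
      _ = _ := by rw [he, he']; ring
  obtain ⟨A, hA, hpA⟩ := exists_norm_schwartz_le p
  obtain ⟨C, hC, H⟩ := exists_integral_norm_tri_le
  have h4 : (4 * -v)⁻¹ = -α := by rw [hα, mul_neg, inv_neg]
  have h5 : -(x / (2 * -v)) = x / (2 * v) := by rw [mul_neg, div_neg, neg_neg]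
  rw [tevol_eq_fresnel (integrable_evolCubic f v) (integrable_ft_evolCubic f v) (neg_ne_zero.2 hv),
    h4, h5]
  simp_rw [hcubic]
  rw [ft_const_mul, ft_comp_div h2v, hW, ft_cubic p.continuous p.integrable
    (integrable_ft_schwartz p) (H p A p.continuous hA.le hpA x).1, hp]
  simp_rw [tri_chirp_mul]
  rw [integral_const_mul]
  have h_int : ∀ z : ℝ × ℝ, tri f x z * Complex.exp (-((2 * α * (z.1 * z.2) : ℝ) : ℂ) * Complex.I) =
      tri f x z * Complex.exp (((-(1 / 2 * (z.1 * z.2) / v) : ℝ) : ℂ) * Complex.I) := by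
    intro z
    congr 3
    rw [← Complex.ofReal_neg]
    congr 2
    rw [hα]
    field_simp
    norm_num
  simp_rw [h_int]
  set J := ∫ z, tri f x z * Complex.exp (((-(1 / 2 * (z.1 * z.2) / v) : ℝ) : ℂ) * Complex.I)
  have he' : Complex.exp (Complex.I * ((-α * x ^ 2 : ℝ) : ℂ)) *
      Complex.exp (Complex.I * ((α * x ^ 2 : ℝ) : ℂ)) = 1 := by
    rw [← Complex.exp_add]
    simp
  have hm : ((|2 * v|⁻¹ : ℝ) : ℂ) * ((|2 * v| : ℝ) : ℂ) = 1 := by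
    rw [← Complex.ofReal_mul, inv_mul_cancel₀ (abs_ne_zero.2 h2v), Complex.ofReal_one]
  have hfin : ((|2 * v|⁻¹ : ℝ) : ℂ) * ((2 * Real.pi : ℝ) : ℂ)⁻¹ =
      (((4 * Real.pi * |v|)⁻¹ : ℝ) : ℂ) := by
    rw [← Complex.ofReal_inv, ← Complex.ofReal_mul, ← mul_inv, abs_mul, abs_of_pos (two_pos (α := ℝ))]
    congr 2
    ring
  have hcn : fresnelConst (-v) * c = _ := fresnelConst_neg_mul hv
  rw [← hfin]
  linear_combination (fresnelConst (-v) * c * ((2 * Real.pi : ℝ) : ℂ)⁻¹ * J *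
    (((|2 * v|⁻¹ : ℝ) : ℂ) * ((|2 * v| : ℝ) : ℂ))) * he' +
    (fresnelConst (-v) * c * ((2 * Real.pi : ℝ) : ℂ)⁻¹ * J) * hm +
    (((2 * Real.pi : ℝ) : ℂ)⁻¹ * J) * hcn

theorem cutoff_mul_tevol_neg_evolCubic {η : ℝ} (hη : 0 < η) (v x : ℝ) :
    ((max 0 (|v| - η) / |v| : ℝ) : ℂ) * Tevol (-v) (evolCubic f v) x =
      (((4 * Real.pi)⁻¹ : ℝ) : ℂ) * ∫ z, tri f x z * fresnelCutoff η (1 / 2 * (z.1 * z.2)) v := by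
  rcases eq_or_ne v 0 with rfl | hv
  · have : ∀ z : ℝ × ℝ, fresnelCutoff η (1 / 2 * (z.1 * z.2)) 0 = 0 :=
      fun z ↦ fresnelCutoff_eq_zero (by simpa using hη.le)
    simp_rw [this]
    simp
  rw [tevol_neg_evolCubic_eq f hv]
  simp_rw [fresnelCutoff, mul_left_comm (tri f x _)]
  rw [integral_const_mul, ← mul_assoc, ← mul_assoc, ← Complex.ofReal_mul, ← Complex.ofReal_mul,
    ← sq_abs v]
  congr 2
  have := abs_ne_zero.2 hv
  field_simp

theorem exists_norm_tevol_neg_evolCubic_le :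
    ∃ B, ∀ v x, ‖Tevol (-v) (evolCubic f v) x‖ ≤ B := by
  obtain ⟨B, hB0, hB⟩ := exists_norm_phaseInt_ft_le f
  refine ⟨(√(2 * Real.pi))⁻¹ * ∫ k, B * ((1 + |k|) ^ 2)⁻¹, fun v x ↦ ?_⟩
  rw [tevol_neg_evolCubic]
  refine (norm_ft_le _ _).trans ?_
  gcongr
  · exact (integrable_phaseInt f v).norm
  · exact integrable_inv_one_add_abs_sq.const_mul B
  · exact fun k ↦ hB v k

theorem measurable_tevol_neg_evolCubic (x : ℝ) :
    Measurable fun v ↦ Tevol (-v) (evolCubic f v) x := by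
  obtain ⟨φ, hφ⟩ := exists_schwartz_eq_ft f
  simp_rw [tevol_neg_evolCubic, ft]
  refine Measurable.const_mul ?_ _
  have h : Measurable (Function.uncurry fun v k : ℝ ↦
      Complex.exp (Complex.I * ((-x : ℝ) : ℂ) * k) * phaseInt (ft f) v k) :=
    (Continuous.measurable (by fun_prop)).mul (measurable_phaseInt (hφ ▸ φ.continuous))
  exact (h.stronglyMeasurable.integral_prod_right (ν := volume)).measurable

theorem ofReal_norm_integral_tevol_le {L : ℝ} (hL : 0 ≤ L) {E : ℝ → ℝ} (hE : Continuous E)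
    {U K : ℝ} (hU : ∀ s, |E s| ≤ U) (hE0 : ∀ᵐ s ∂(volume.restrict (Ioc 0 L)), E s ≠ 0)
    (hK0 : 0 ≤ K)
    (hK : ∀ Θ : ℝ → ℂ, Continuous Θ → ∀ M, (∀ s, ‖∫ v in (0:ℝ)..E s, Θ v‖ ≤ M) →
      ‖∫ s in (0:ℝ)..L, Θ (E s)‖ ≤ K * M) (x : ℝ) :
    ENNReal.ofReal ‖∫ s in (0:ℝ)..L, Tevol (-(E s)) (evolCubic f (E s)) x‖ ≤
      ENNReal.ofReal ((4 * Real.pi)⁻¹ * (K * (2 + U) * (√(1 / 2))⁻¹)) *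
        triConv (fun x ↦ ‖f x‖) x := by
  obtain ⟨B, hB⟩ := exists_norm_tevol_neg_evolCubic_le f
  obtain ⟨A, hA, hfA⟩ := exists_norm_schwartz_le f
  obtain ⟨C, hC, H⟩ := exists_integral_norm_tri_le
  have hpi := Real.pi_pos
  have hU0 : 0 ≤ U := (abs_nonneg _).trans (hU 0)
  set F : ℝ → ℂ := fun s ↦ Tevol (-(E s)) (evolCubic f (E s)) x with hF
  have hFm : Measurable F := (measurable_tevol_neg_evolCubic f x).comp hE.measurable
  have hlim : Tendsto (fun η : ℝ ↦ ∫ s in (0:ℝ)..L,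
      ((max 0 (|E s| - η) / |E s| : ℝ) : ℂ) * F s) (𝓝[>] 0) (𝓝 (∫ s in (0:ℝ)..L, F s)) := by
    simp_rw [intervalIntegral.integral_of_le hL]
    refine tendsto_integral_filter_of_dominated_convergence (fun _ ↦ B) ?_ ?_
      (integrable_const _) ?_
    · refine Eventually.of_forall fun η ↦ Measurable.aestronglyMeasurable ?_
      have := hE.measurable
      fun_prop
    · filter_upwards [self_mem_nhdsWithin] with η hη
      refine Eventually.of_forall fun s ↦ ?_
      have hη' := mem_Ioi.1 hη
      rw [norm_mul, Complex.norm_real, Real.norm_eq_abs, abs_of_nonneg (by positivity)]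
      refine (mul_le_of_le_one_left (norm_nonneg _) (div_le_one_of_le₀ ?_ (abs_nonneg _))).trans
        (hB _ _)
      exact max_le (abs_nonneg _) (by linarith)
    · refine hE0.mono fun s hs ↦ ?_
      have hs' := abs_pos.2 hs
      have hcont : Continuous fun η : ℝ ↦ ((max 0 (|E s| - η) / |E s| : ℝ) : ℂ) * F s := by
        fun_prop
      have := (hcont.tendsto 0).mono_left (nhdsWithin_le_nhds (s := Ioi 0))
      simpa [max_eq_right hs'.le, hs] using this
  refine le_of_tendsto ((ENNReal.continuous_ofReal.comp continuous_norm).tendsto _ |>.comp hlim) ?_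
  filter_upwards [self_mem_nhdsWithin] with η hη
  have hη' : 0 < η := hη
  simp only [Function.comp_apply, hF]
  simp_rw [cutoff_mul_tevol_neg_evolCubic f hη']
  rw [intervalIntegral.integral_const_mul, norm_mul, ENNReal.ofReal_mul (norm_nonneg _),
    Complex.norm_real, Real.norm_eq_abs, abs_of_pos (by positivity),
    ENNReal.ofReal_mul (by positivity), mul_assoc]
  gcongr
  refine ofReal_norm_integral_tri_le (H f A f.continuous hA.le hfA x).1
    (θ := fun v z ↦ fresnelCutoff η (1 / 2 * (z.1 * z.2)) v)
    (measurable_fresnelCutoff_mul η (1 / 2)) (fun v z ↦ norm_fresnelCutoff_le hη' _ _) hE hL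
    (by positivity) fun z hz1 hz2 ↦ ?_
  refine (hK _ (continuous_fresnelCutoff hη' _) _ fun s ↦ norm_integral_fresnelCutoff_le hη' (hU s)
    (by positivity)).trans (le_of_eq ?_)
  rw [div_eq_mul_inv, inv_sqrt_abs_mul (by norm_num)]
  ring

end Schwartz

theorem exp_decay_of_eq {L : ℝ} (hL : 0 < L) {E : ℝ → ℝ} (hE : Continuous E) {U K : ℝ}
    (hU : ∀ s, |E s| ≤ U) (hE0 : ∀ᵐ s ∂(volume.restrict (Ioc 0 L)), E s ≠ 0) (hK0 : 0 ≤ K)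
    (hK : ∀ Θ : ℝ → ℂ, Continuous Θ → ∀ M, (∀ s, ‖∫ v in (0:ℝ)..E s, Θ v‖ ≤ M) →
      ‖∫ s in (0:ℝ)..L, Θ (E s)‖ ≤ K * M)
    {ω d : ℝ} (hω : 0 < ω) (hd : 0 ≤ d) (f : 𝓢(ℝ, ℂ))
    (heq : ∀ x, (ω : ℂ) * f x = (d : ℂ) * deriv (deriv f) x +
      ((1 / L : ℝ) : ℂ) * ∫ s in (0:ℝ)..L, Tevol (-(E s)) (evolCubic f (E s)) x) :
    ∃ K > 0, ∃ μ > 0, ∀ x, ‖f x‖ ≤ K * Real.exp (-μ * |x|) := by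
  have hpi := Real.pi_pos
  have hU0 : 0 ≤ U := (abs_nonneg _).trans (hU 0)
  obtain ⟨A, hA, hfA⟩ := exists_norm_schwartz_le f
  set M := (1 / L) * ((4 * Real.pi)⁻¹ * (K * (2 + U) * (√(1 / 2))⁻¹)) + 1 with hM
  have hM0 : 0 < M := by positivity
  have hR : ∀ x, ENNReal.ofReal ‖(ω : ℂ) * f x - (d : ℂ) * deriv (deriv f) x‖ ≤
      ENNReal.ofReal M * triConv (fun x ↦ ‖f x‖) x := by
    intro x
    rw [heq x, add_sub_cancel_left, norm_mul, Complex.norm_real, Real.norm_eq_abs,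
      abs_of_pos (by positivity), ENNReal.ofReal_mul (by positivity)]
    calc _ ≤ ENNReal.ofReal (1 / L) * (ENNReal.ofReal ((4 * Real.pi)⁻¹ *
          (K * (2 + U) * (√(1 / 2))⁻¹)) * triConv (fun x ↦ ‖f x‖) x) := by
          gcongr
          exact ofReal_norm_integral_tevol_le f hL.le hE hU hE0 hK0 hK x
      _ = ENNReal.ofReal ((1 / L) * ((4 * Real.pi)⁻¹ * (K * (2 + U) * (√(1 / 2))⁻¹))) *
          triConv (fun x ↦ ‖f x‖) x := by
          rw [← mul_assoc, ← ENNReal.ofReal_mul (by positivity)]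
      _ ≤ _ := by
          gcongr
          linarith
  rcases hd.eq_or_lt with rfl | hd'
  · refine exp_decay_of_ofReal_le_triConv (g := fun x ↦ ‖f x‖) (M := ω⁻¹ * M)
      (fun _ ↦ norm_nonneg _) hA (by positivity) hfA fun x ↦ ?_
    have h := hR x
    rw [Complex.ofReal_zero, zero_mul, sub_zero, norm_mul, Complex.norm_real, Real.norm_eq_abs,
      abs_of_pos hω] at h
    calc ENNReal.ofReal ‖f x‖ = ENNReal.ofReal ω⁻¹ * ENNReal.ofReal (ω * ‖f x‖) := by
          rw [← ENNReal.ofReal_mul (by positivity), inv_mul_cancel_left₀ hω.ne']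
      _ ≤ ENNReal.ofReal ω⁻¹ * (ENNReal.ofReal M * triConv (fun x ↦ ‖f x‖) x) := by gcongr
      _ = _ := by rw [← mul_assoc, ← ENNReal.ofReal_mul (by positivity)]
  · set κ := √(ω / d) with hκ
    have hκ0 : 0 < κ := Real.sqrt_pos.2 (by positivity)
    have hκ2 : κ ^ 2 = ω / d := Real.sq_sqrt (by positivity)
    obtain ⟨Cs, hCs, hV⟩ := exists_weight_le_exp_mul hκ0
    obtain ⟨C, hC, H⟩ := exists_triConv_le
    have h1 : (SchwartzMap.derivCLM ℂ ℂ f : ℝ → ℂ) = deriv f := by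
      ext x
      simp
    have h2 : (SchwartzMap.derivCLM ℂ ℂ (SchwartzMap.derivCLM ℂ ℂ f) : ℝ → ℂ) =
        deriv (deriv f) := by
      ext x
      simp [h1]
    have hbd : ∀ g : 𝓢(ℝ, ℂ), ∃ B, ∀ x, ‖g x‖ ≤ B := by
      intro g
      obtain ⟨B, hB0, hB⟩ := exists_norm_schwartz_le g
      refine ⟨B, fun x ↦ (hB x).trans (mul_le_of_le_one_right hB0.le (inv_le_one_of_one_le₀ ?_))⟩
      exact one_le_pow₀ (by linarith [abs_nonneg x])
    obtain ⟨B₁, hB₁⟩ := hbd f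
    obtain ⟨B₂, hB₂⟩ := hbd (SchwartzMap.derivCLM ℂ ℂ f)
    rw [h1] at hB₂
    refine exp_decay_of_bootstrap (μ₀ := κ / 4) (C := d⁻¹ * M * C * (2 * Cs / κ) ^ 2) hA
      (by positivity) (by positivity) hfA fun μ hμ hμκ n N hn hN hfN x ↦ ?_
    have hWpos : ∀ x, 0 < (√(1 + |x|))⁻¹ * decayWeight μ n x := fun x ↦ by
      have := decayWeight_pos μ n x
      positivity
    have hRle : ∀ x, ‖(κ : ℂ) ^ 2 * f x - deriv (deriv f) x‖ ≤
        d⁻¹ * (M * C * N ^ 3) * ((√(1 + |x|))⁻¹ * decayWeight μ n x) := by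
      intro x
      have h3 := le_of_ofReal_le_triConv hM0.le hC.le hN (hWpos x).le (hR x)
        (H _ μ n N (fun _ ↦ norm_nonneg _) hμ hn hN hfN x)
      have h4 : (κ : ℂ) ^ 2 * f x - deriv (deriv f) x =
          ((d⁻¹ : ℝ) : ℂ) * ((ω : ℂ) * f x - (d : ℂ) * deriv (deriv f) x) := by
        rw [← Complex.ofReal_pow, hκ2]
        push_cast
        have : (d : ℂ) ≠ 0 := by exact_mod_cast hd'.ne'
        field_simp
      rw [h4, norm_mul, Complex.norm_real, Real.norm_eq_abs, abs_of_pos (by positivity), mul_assoc]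
      gcongr
    have h5 := norm_le_of_resolvent_le hκ0 (V := fun x ↦ (√(1 + |x|))⁻¹ * decayWeight μ n x)
      (hV μ n hμ hμκ) (by positivity) hCs.le (u := f) (u' := deriv f) (u'' := deriv (deriv f))
      (B := max B₁ B₂) (fun x ↦ f.differentiableAt.hasDerivAt)
      (fun x ↦ (h1 ▸ (SchwartzMap.derivCLM ℂ ℂ f).differentiableAt :
        DifferentiableAt ℝ (deriv f) x).hasDerivAt)
      (h2 ▸ (SchwartzMap.derivCLM ℂ ℂ (SchwartzMap.derivCLM ℂ ℂ f)).continuous)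
      (fun x ↦ (hB₁ x).trans (le_max_left _ _)) (fun x ↦ (hB₂ x).trans (le_max_right _ _)) hRle x
    refine h5.trans (le_of_eq ?_)
    ring

/-- Exponential decay of dispersion managed solitons: any Schwartz solution of
the dispersion management equation, together with its Fourier transform, decays
exponentially. -/
theorem exp_decay_dispersion_managed_soliton
    (L : ℝ) (hL : 0 < L) (d0 : ℝ → ℝ)
    (hd0int : IntegrableOn d0 (Icc 0 L))
    (D : ℝ → ℝ) (hD : ∀ s, D s = ∫ t in (0:ℝ)..s, d0 t)
    (hbdd : ∃ δ > (0:ℝ), ∀ᵐ s ∂(volume.restrict (Icc (0:ℝ) L)), δ ≤ |d0 s|)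
    (hpw : ∃ N : ℕ, 0 < N ∧ ∃ c : ℕ → ℝ,
      c 0 = 0 ∧ c N = L ∧ (∀ j < N, c j < c (j + 1)) ∧
      (∀ j < N, ∃ g g' : ℝ → ℝ,
        IntegrableOn g' (Ioo (c j) (c (j + 1))) ∧
        (∀ x ∈ Ioo (c j) (c (j + 1)), ∀ y ∈ Ioo (c j) (c (j + 1)),
          g y - g x = ∫ t in x..y, g' t) ∧
        (∀ᵐ s ∂(volume.restrict (Ioo (c j) (c (j + 1)))), d0 s = g s)))
    (ω dav : ℝ) (hω : 0 < ω) (hdav : 0 ≤ dav)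
    (f : SchwartzMap ℝ ℂ)
    (heq : ∀ x : ℝ,
      (ω : ℂ) * f x = (dav : ℂ) * deriv (deriv (⇑f)) x +
        ((1 / L : ℝ) : ℂ) * ∫ s in (0:ℝ)..L,
          Tevol (-(D s))
            (fun y => Tevol (D s) (⇑f) y * (starRingEnd ℂ) (Tevol (D s) (⇑f) y) *
              Tevol (D s) (⇑f) y) x) :
    ∃ C > (0:ℝ), ∃ μ > (0:ℝ),
      (∀ x : ℝ, ‖f x‖ ≤ C * Real.exp (-μ * |x|)) ∧
      (∀ k : ℝ, ‖ft (⇑f) k‖ ≤ C * Real.exp (-μ * |k|)) := by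
  obtain ⟨E, hE, hED, ⟨U, hU0, hU⟩, hE0, K, hK0, hK⟩ :=
    exists_continuous_profile hL hd0int hD hbdd hpw
  have heq' : ∀ x, (ω : ℂ) * f x = (dav : ℂ) * deriv (deriv f) x +
      ((1 / L : ℝ) : ℂ) * ∫ s in (0:ℝ)..L, Tevol (-(E s)) (evolCubic f (E s)) x := by
    intro x
    rw [heq x]
    congr 2
    refine intervalIntegral.integral_congr fun s hs ↦ ?_
    rw [uIcc_of_le hL.le] at hs
    rw [hED s hs]
    rfl
  obtain ⟨C₁, hC₁, μ₁, hμ₁, h₁⟩ := exp_decay_of_eq hL hE hU hE0 hK0 hK hω hdav f heq'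
  obtain ⟨C₂, hC₂, μ₂, hμ₂, h₂⟩ := exp_decay_ft_of_eq hL hE hU hK0 hK hω hdav f heq'
  refine ⟨max C₁ C₂, lt_max_of_lt_left hC₁, min μ₁ μ₂, lt_min hμ₁ hμ₂, fun x ↦ ?_, fun k ↦ ?_⟩
  · refine (h₁ x).trans ?_
    gcongr
    · exact le_max_left _ _
    · exact min_le_left _ _
  · refine (h₂ k).trans ?_
    gcongr
    · exact le_max_right _ _
    · exact min_le_right _ _
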